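/- arXiv:2109.13335 — 3 statements merged into one kernel-verified Lean document; each statement's English description precedes it below -/
import Mathlib

section
/- With f1, f2, f3 independent uniformly random functions, for each triple u = (x,y,z) ∈ [m]^3 with x ∨ y ∨ z = 1⃗ let E_u be the event that f1(x) = i*, f2(y) = j*, f3(z) = k*; write E_u ∼ E_{u'} for u ≠ u' iff the triples u = (x,y,z) and u' = (x',y',z') satisfy x = x' or y = y' or z = z'. Then μ := Σ_u P(E_u) = b^3 · 7^s / ψ3, and Δ := Σ_{u, u' : E_u ∼ E_{u'}} P(E_u ∩ E_{u'}) ≤ (ψ1 · b^5 · 25^s + ψ2 · b^4 · 13^s) / ψ3^2. -/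
/-- `[m]` with `m = 2^s·b`, identified with `{0,1}^s × [b]`. -/
abbrev BMMIdx (s b : ℕ) : Type := (Fin s → Bool) × Fin b

/-- The sample space for the three independent uniformly random functions
`f1 : [m] → [d1]`, `f2 : [m] → [d2]`, `f3 : [m] → [d3]` (uniform measure on this
finite set of triples of functions). -/
abbrev BMMSamp (s b d1 d2 d3 : ℕ) : Type :=
  (BMMIdx s b → Fin d1) × (BMMIdx s b → Fin d2) × (BMMIdx s b → Fin d3)


/-- The set of good triples. -/
def trip (s b : ℕ) : Finset (BMMIdx s b × BMMIdx s b × BMMIdx s b) :=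
  Finset.univ.filter (fun u => ∀ i, (u.1.1 i || u.2.1.1 i || u.2.2.1 i) = true)

lemma trip_card (s b : ℕ) : (trip s b).card = 7 ^ s * b ^ 3 := by
  classical
  set C : Finset (Bool × Bool × Bool) := Finset.univ.filter (fun c =>
    (c.1 || c.2.1 || c.2.2) = true) with hC
  have hCc : C.card = 7 := by rw [hC]; decide
  have h : ((Fintype.piFinset (fun _ : Fin s => C)) ×ˢ
      (Finset.univ : Finset (Fin b × Fin b × Fin b))).card = 7 ^ s * b ^ 3 := by
    rw [Finset.card_product, Fintype.card_piFinset]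
    simp [hCc]
    ring
  rw [← h]
  refine Finset.card_nbij'
    (fun p => (fun i => (p.1.1 i, p.2.1.1 i, p.2.2.1 i), (p.1.2, p.2.1.2, p.2.2.2)))
    (fun q => ((fun i => (q.1 i).1, q.2.1), (fun i => (q.1 i).2.1, q.2.2.1),
      (fun i => (q.1 i).2.2, q.2.2.2))) ?_ ?_ ?_ ?_
  · intro p hp
    simpa [trip, hC] using hp
  · intro p hp
    simpa [trip, hC] using hp
  · intro p hp
    rfl
  · intro p hp
    rfl

lemma fn_count {α : Type*} [Fintype α] [DecidableEq α] (d : ℕ) (hd : 0 < d) (i : Fin d) (x y : α) :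
    (((Finset.univ : Finset (α → Fin d)).filter (fun f => f x = i ∧ f y = i)).card : ℝ) /
      (Fintype.card (α → Fin d) : ℝ) = if x = y then 1 / (d : ℝ) else 1 / (d : ℝ) ^ 2 := by
  have hd' : (d : ℝ) ≠ 0 := by positivity
  have h1 : (Finset.univ : Finset (α → Fin d)).filter (fun f => f x = i ∧ f y = i) =
      Fintype.piFinset (fun a => if a ∈ ({x, y} : Finset α) then {i} else Finset.univ) := by
    ext f
    simp only [Finset.mem_filter, Finset.mem_univ, true_and, Fintype.mem_piFinset]
    constructor
    · rintro ⟨h, h'⟩ a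
      split_ifs with ha
      · simp only [Finset.mem_insert, Finset.mem_singleton] at ha
        rcases ha with rfl | rfl <;> simpa
      · simp
    · intro h
      have hx := h x
      have hy := h y
      simp at hx hy
      exact ⟨hx, hy⟩
  have h2 : (Fintype.card (α → Fin d) : ℝ) = ∏ _a : α, (d : ℝ) := by simp
  rw [h1, Fintype.card_piFinset, h2, Nat.cast_prod, ← Finset.prod_div_distrib]
  have h3 : ∀ a : α, (((if a ∈ ({x, y} : Finset α) then {i} else Finset.univ : Finset (Fin d)).card
      : ℝ) / d) = if a ∈ ({x, y} : Finset α) then 1 / (d : ℝ) else 1 := by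
    intro a
    split_ifs
    · simp
    · simp [hd']
  rw [Finset.prod_congr rfl (fun a _ => h3 a), Finset.prod_ite_mem, Finset.univ_inter,
    Finset.prod_const]
  split_ifs with h
  · subst h; simp
  · rw [Finset.card_pair h]; simp

lemma samp_count (s b d1 d2 d3 : ℕ) (hd1 : 0 < d1) (hd2 : 0 < d2) (hd3 : 0 < d3)
    (istar : Fin d1) (jstar : Fin d2) (kstar : Fin d3)
    (u v : BMMIdx s b × BMMIdx s b × BMMIdx s b) :
    ((((Finset.univ : Finset (BMMSamp s b d1 d2 d3)).filter (fun ω =>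
        ω.1 u.1 = istar ∧ ω.2.1 u.2.1 = jstar ∧ ω.2.2 u.2.2 = kstar)) ∩
      ((Finset.univ : Finset (BMMSamp s b d1 d2 d3)).filter (fun ω =>
        ω.1 v.1 = istar ∧ ω.2.1 v.2.1 = jstar ∧ ω.2.2 v.2.2 = kstar))).card : ℝ) /
      (Fintype.card (BMMSamp s b d1 d2 d3) : ℝ) =
    (if u.1 = v.1 then 1 / (d1 : ℝ) else 1 / (d1 : ℝ) ^ 2) *
    ((if u.2.1 = v.2.1 then 1 / (d2 : ℝ) else 1 / (d2 : ℝ) ^ 2) *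
    (if u.2.2 = v.2.2 then 1 / (d3 : ℝ) else 1 / (d3 : ℝ) ^ 2)) := by
  rw [← fn_count d1 hd1 istar, ← fn_count d2 hd2 jstar, ← fn_count d3 hd3 kstar,
    div_mul_div_comm, div_mul_div_comm]
  rw [Fintype.card_prod, Fintype.card_prod, Nat.cast_mul, Nat.cast_mul]
  congr 1
  rw [← Nat.cast_mul, ← Nat.cast_mul, ← Finset.card_product, ← Finset.card_product]
  congr 2
  ext ω
  simp only [Finset.mem_inter, Finset.mem_filter, Finset.mem_univ, true_and, Finset.mem_product]
  tauto

lemma cnt_cx (s b : ℕ) :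
    (((trip s b) ×ˢ (trip s b)).filter (fun p => p.1.1 = p.2.1)).card ≤ 25 ^ s * b ^ 5 := by
  classical
  set C : Finset (Bool × Bool × Bool × Bool × Bool) := Finset.univ.filter (fun c =>
    (c.1 || c.2.1 || c.2.2.1) = true ∧ (c.1 || c.2.2.2.1 || c.2.2.2.2) = true) with hC
  have hCc : C.card = 25 := by rw [hC]; decide
  have h : ((Fintype.piFinset (fun _ : Fin s => C)) ×ˢ
      (Finset.univ : Finset (Fin b × Fin b × Fin b × Fin b × Fin b))).card = 25 ^ s * b ^ 5 := by
    rw [Finset.card_product, Fintype.card_piFinset]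
    simp [hCc]
    ring
  rw [← h]
  refine Finset.card_le_card_of_injOn
    (fun p => (fun i => (p.1.1.1 i, p.1.2.1.1 i, p.1.2.2.1 i, p.2.2.1.1 i, p.2.2.2.1 i), (p.1.1.2, p.1.2.1.2, p.1.2.2.2, p.2.2.1.2, p.2.2.2.2))) ?_ ?_
  · intro p hp
    simp only [Finset.coe_filter, Finset.mem_product, trip, Finset.mem_filter, Finset.mem_univ,
      true_and, Set.mem_ofPred_eq] at hp
    obtain ⟨⟨h1, h2⟩, h3⟩ := hp
    simp only [Finset.coe_product, Finset.coe_univ, Set.mem_prod, Set.mem_univ, and_true,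
      Finset.mem_coe, Fintype.mem_piFinset, hC, Finset.mem_filter, Finset.mem_univ, true_and]
    intro i
    have h1 := h1 i
    have h2 := h2 i
    simp only [h3] at h1 h2 ⊢
    exact ⟨h1, h2⟩
  · rintro ⟨⟨⟨a1, a1'⟩, ⟨a2, a2'⟩, ⟨a3, a3'⟩⟩, ⟨⟨a4, a4'⟩, ⟨a5, a5'⟩, ⟨a6, a6'⟩⟩⟩ hp
      ⟨⟨⟨c1, c1'⟩, ⟨c2, c2'⟩, ⟨c3, c3'⟩⟩, ⟨⟨c4, c4'⟩, ⟨c5, c5'⟩, ⟨c6, c6'⟩⟩⟩ hq hpq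
    simp only [Finset.coe_filter, Set.mem_ofPred_eq, Prod.mk.injEq] at hp hq
    simp only [Prod.mk.injEq, funext_iff] at hpq hp hq ⊢
    grind

lemma cnt_cy (s b : ℕ) :
    (((trip s b) ×ˢ (trip s b)).filter (fun p => p.1.2.1 = p.2.2.1)).card ≤ 25 ^ s * b ^ 5 := by
  classical
  set C : Finset (Bool × Bool × Bool × Bool × Bool) := Finset.univ.filter (fun c =>
    (c.1 || c.2.1 || c.2.2.1) = true ∧ (c.2.2.2.1 || c.2.1 || c.2.2.2.2) = true) with hC
  have hCc : C.card = 25 := by rw [hC]; decide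
  have h : ((Fintype.piFinset (fun _ : Fin s => C)) ×ˢ
      (Finset.univ : Finset (Fin b × Fin b × Fin b × Fin b × Fin b))).card = 25 ^ s * b ^ 5 := by
    rw [Finset.card_product, Fintype.card_piFinset]
    simp [hCc]
    ring
  rw [← h]
  refine Finset.card_le_card_of_injOn
    (fun p => (fun i => (p.1.1.1 i, p.1.2.1.1 i, p.1.2.2.1 i, p.2.1.1 i, p.2.2.2.1 i), (p.1.1.2, p.1.2.1.2, p.1.2.2.2, p.2.1.2, p.2.2.2.2))) ?_ ?_
  · intro p hp
    simp only [Finset.coe_filter, Finset.mem_product, trip, Finset.mem_filter, Finset.mem_univ,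
      true_and, Set.mem_ofPred_eq] at hp
    obtain ⟨⟨h1, h2⟩, h3⟩ := hp
    simp only [Finset.coe_product, Finset.coe_univ, Set.mem_prod, Set.mem_univ, and_true,
      Finset.mem_coe, Fintype.mem_piFinset, hC, Finset.mem_filter, Finset.mem_univ, true_and]
    intro i
    have h1 := h1 i
    have h2 := h2 i
    simp only [h3] at h1 h2 ⊢
    exact ⟨h1, h2⟩
  · rintro ⟨⟨⟨a1, a1'⟩, ⟨a2, a2'⟩, ⟨a3, a3'⟩⟩, ⟨⟨a4, a4'⟩, ⟨a5, a5'⟩, ⟨a6, a6'⟩⟩⟩ hp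
      ⟨⟨⟨c1, c1'⟩, ⟨c2, c2'⟩, ⟨c3, c3'⟩⟩, ⟨⟨c4, c4'⟩, ⟨c5, c5'⟩, ⟨c6, c6'⟩⟩⟩ hq hpq
    simp only [Finset.coe_filter, Set.mem_ofPred_eq, Prod.mk.injEq] at hp hq
    simp only [Prod.mk.injEq, funext_iff] at hpq hp hq ⊢
    grind

lemma cnt_cz (s b : ℕ) :
    (((trip s b) ×ˢ (trip s b)).filter (fun p => p.1.2.2 = p.2.2.2)).card ≤ 25 ^ s * b ^ 5 := by
  classical
  set C : Finset (Bool × Bool × Bool × Bool × Bool) := Finset.univ.filter (fun c =>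
    (c.1 || c.2.1 || c.2.2.1) = true ∧ (c.2.2.2.1 || c.2.2.2.2 || c.2.2.1) = true) with hC
  have hCc : C.card = 25 := by rw [hC]; decide
  have h : ((Fintype.piFinset (fun _ : Fin s => C)) ×ˢ
      (Finset.univ : Finset (Fin b × Fin b × Fin b × Fin b × Fin b))).card = 25 ^ s * b ^ 5 := by
    rw [Finset.card_product, Fintype.card_piFinset]
    simp [hCc]
    ring
  rw [← h]
  refine Finset.card_le_card_of_injOn
    (fun p => (fun i => (p.1.1.1 i, p.1.2.1.1 i, p.1.2.2.1 i, p.2.1.1 i, p.2.2.1.1 i), (p.1.1.2, p.1.2.1.2, p.1.2.2.2, p.2.1.2, p.2.2.1.2))) ?_ ?_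
  · intro p hp
    simp only [Finset.coe_filter, Finset.mem_product, trip, Finset.mem_filter, Finset.mem_univ,
      true_and, Set.mem_ofPred_eq] at hp
    obtain ⟨⟨h1, h2⟩, h3⟩ := hp
    simp only [Finset.coe_product, Finset.coe_univ, Set.mem_prod, Set.mem_univ, and_true,
      Finset.mem_coe, Fintype.mem_piFinset, hC, Finset.mem_filter, Finset.mem_univ, true_and]
    intro i
    have h1 := h1 i
    have h2 := h2 i
    simp only [h3] at h1 h2 ⊢
    exact ⟨h1, h2⟩
  · rintro ⟨⟨⟨a1, a1'⟩, ⟨a2, a2'⟩, ⟨a3, a3'⟩⟩, ⟨⟨a4, a4'⟩, ⟨a5, a5'⟩, ⟨a6, a6'⟩⟩⟩ hp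
      ⟨⟨⟨c1, c1'⟩, ⟨c2, c2'⟩, ⟨c3, c3'⟩⟩, ⟨⟨c4, c4'⟩, ⟨c5, c5'⟩, ⟨c6, c6'⟩⟩⟩ hq hpq
    simp only [Finset.coe_filter, Set.mem_ofPred_eq, Prod.mk.injEq] at hp hq
    simp only [Prod.mk.injEq, funext_iff] at hpq hp hq ⊢
    grind

lemma cnt_cxy (s b : ℕ) :
    (((trip s b) ×ˢ (trip s b)).filter (fun p => p.1.1 = p.2.1 ∧ p.1.2.1 = p.2.2.1)).card ≤ 13 ^ s * b ^ 4 := by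
  classical
  set C : Finset (Bool × Bool × Bool × Bool) := Finset.univ.filter (fun c =>
    (c.1 || c.2.1 || c.2.2.1) = true ∧ (c.1 || c.2.1 || c.2.2.2) = true) with hC
  have hCc : C.card = 13 := by rw [hC]; decide
  have h : ((Fintype.piFinset (fun _ : Fin s => C)) ×ˢ
      (Finset.univ : Finset (Fin b × Fin b × Fin b × Fin b))).card = 13 ^ s * b ^ 4 := by
    rw [Finset.card_product, Fintype.card_piFinset]
    simp [hCc]
    ring
  rw [← h]
  refine Finset.card_le_card_of_injOn
    (fun p => (fun i => (p.1.1.1 i, p.1.2.1.1 i, p.1.2.2.1 i, p.2.2.2.1 i), (p.1.1.2, p.1.2.1.2, p.1.2.2.2, p.2.2.2.2))) ?_ ?_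
  · intro p hp
    simp only [Finset.coe_filter, Finset.mem_product, trip, Finset.mem_filter, Finset.mem_univ,
      true_and, Set.mem_ofPred_eq] at hp
    obtain ⟨⟨h1, h2⟩, h3⟩ := hp
    simp only [Finset.coe_product, Finset.coe_univ, Set.mem_prod, Set.mem_univ, and_true,
      Finset.mem_coe, Fintype.mem_piFinset, hC, Finset.mem_filter, Finset.mem_univ, true_and]
    intro i
    have h1 := h1 i
    have h2 := h2 i
    simp only [h3] at h1 h2 ⊢
    exact ⟨h1, h2⟩
  · rintro ⟨⟨⟨a1, a1'⟩, ⟨a2, a2'⟩, ⟨a3, a3'⟩⟩, ⟨⟨a4, a4'⟩, ⟨a5, a5'⟩, ⟨a6, a6'⟩⟩⟩ hp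
      ⟨⟨⟨c1, c1'⟩, ⟨c2, c2'⟩, ⟨c3, c3'⟩⟩, ⟨⟨c4, c4'⟩, ⟨c5, c5'⟩, ⟨c6, c6'⟩⟩⟩ hq hpq
    simp only [Finset.coe_filter, Set.mem_ofPred_eq, Prod.mk.injEq] at hp hq
    simp only [Prod.mk.injEq, funext_iff] at hpq hp hq ⊢
    grind

lemma cnt_cxz (s b : ℕ) :
    (((trip s b) ×ˢ (trip s b)).filter (fun p => p.1.1 = p.2.1 ∧ p.1.2.2 = p.2.2.2)).card ≤ 13 ^ s * b ^ 4 := by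
  classical
  set C : Finset (Bool × Bool × Bool × Bool) := Finset.univ.filter (fun c =>
    (c.1 || c.2.1 || c.2.2.1) = true ∧ (c.1 || c.2.2.2 || c.2.2.1) = true) with hC
  have hCc : C.card = 13 := by rw [hC]; decide
  have h : ((Fintype.piFinset (fun _ : Fin s => C)) ×ˢ
      (Finset.univ : Finset (Fin b × Fin b × Fin b × Fin b))).card = 13 ^ s * b ^ 4 := by
    rw [Finset.card_product, Fintype.card_piFinset]
    simp [hCc]
    ring
  rw [← h]
  refine Finset.card_le_card_of_injOn
    (fun p => (fun i => (p.1.1.1 i, p.1.2.1.1 i, p.1.2.2.1 i, p.2.2.1.1 i), (p.1.1.2, p.1.2.1.2, p.1.2.2.2, p.2.2.1.2))) ?_ ?_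
  · intro p hp
    simp only [Finset.coe_filter, Finset.mem_product, trip, Finset.mem_filter, Finset.mem_univ,
      true_and, Set.mem_ofPred_eq] at hp
    obtain ⟨⟨h1, h2⟩, h3⟩ := hp
    simp only [Finset.coe_product, Finset.coe_univ, Set.mem_prod, Set.mem_univ, and_true,
      Finset.mem_coe, Fintype.mem_piFinset, hC, Finset.mem_filter, Finset.mem_univ, true_and]
    intro i
    have h1 := h1 i
    have h2 := h2 i
    simp only [h3] at h1 h2 ⊢
    exact ⟨h1, h2⟩
  · rintro ⟨⟨⟨a1, a1'⟩, ⟨a2, a2'⟩, ⟨a3, a3'⟩⟩, ⟨⟨a4, a4'⟩, ⟨a5, a5'⟩, ⟨a6, a6'⟩⟩⟩ hp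
      ⟨⟨⟨c1, c1'⟩, ⟨c2, c2'⟩, ⟨c3, c3'⟩⟩, ⟨⟨c4, c4'⟩, ⟨c5, c5'⟩, ⟨c6, c6'⟩⟩⟩ hq hpq
    simp only [Finset.coe_filter, Set.mem_ofPred_eq, Prod.mk.injEq] at hp hq
    simp only [Prod.mk.injEq, funext_iff] at hpq hp hq ⊢
    grind

lemma cnt_cyz (s b : ℕ) :
    (((trip s b) ×ˢ (trip s b)).filter (fun p => p.1.2.1 = p.2.2.1 ∧ p.1.2.2 = p.2.2.2)).card ≤ 13 ^ s * b ^ 4 := by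
  classical
  set C : Finset (Bool × Bool × Bool × Bool) := Finset.univ.filter (fun c =>
    (c.1 || c.2.1 || c.2.2.1) = true ∧ (c.2.2.2 || c.2.1 || c.2.2.1) = true) with hC
  have hCc : C.card = 13 := by rw [hC]; decide
  have h : ((Fintype.piFinset (fun _ : Fin s => C)) ×ˢ
      (Finset.univ : Finset (Fin b × Fin b × Fin b × Fin b))).card = 13 ^ s * b ^ 4 := by
    rw [Finset.card_product, Fintype.card_piFinset]
    simp [hCc]
    ring
  rw [← h]
  refine Finset.card_le_card_of_injOn
    (fun p => (fun i => (p.1.1.1 i, p.1.2.1.1 i, p.1.2.2.1 i, p.2.1.1 i), (p.1.1.2, p.1.2.1.2, p.1.2.2.2, p.2.1.2))) ?_ ?_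
  · intro p hp
    simp only [Finset.coe_filter, Finset.mem_product, trip, Finset.mem_filter, Finset.mem_univ,
      true_and, Set.mem_ofPred_eq] at hp
    obtain ⟨⟨h1, h2⟩, h3⟩ := hp
    simp only [Finset.coe_product, Finset.coe_univ, Set.mem_prod, Set.mem_univ, and_true,
      Finset.mem_coe, Fintype.mem_piFinset, hC, Finset.mem_filter, Finset.mem_univ, true_and]
    intro i
    have h1 := h1 i
    have h2 := h2 i
    simp only [h3] at h1 h2 ⊢
    exact ⟨h1, h2⟩
  · rintro ⟨⟨⟨a1, a1'⟩, ⟨a2, a2'⟩, ⟨a3, a3'⟩⟩, ⟨⟨a4, a4'⟩, ⟨a5, a5'⟩, ⟨a6, a6'⟩⟩⟩ hp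
      ⟨⟨⟨c1, c1'⟩, ⟨c2, c2'⟩, ⟨c3, c3'⟩⟩, ⟨⟨c4, c4'⟩, ⟨c5, c5'⟩, ⟨c6, c6'⟩⟩⟩ hq hpq
    simp only [Finset.coe_filter, Set.mem_ofPred_eq, Prod.mk.injEq] at hp hq
    simp only [Prod.mk.injEq, funext_iff] at hpq hp hq ⊢
    grind

/-- With `f1, f2, f3` independent uniformly random functions, for triples
`u = (x,y,z)` with `x ∨ y ∨ z = 1⃗` and events `E_u = {f1 x = i* ∧ f2 y = j* ∧ f3 z = k*}`,
with `E_u ∼ E_{u'}` iff `u ≠ u'` and `x = x' ∨ y = y' ∨ z = z'`: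
`μ = b^3·7^s/ψ3` and `Δ ≤ (ψ1·b^5·25^s + ψ2·b^4·13^s)/ψ3^2`. -/
theorem bmm_mu_delta (s b d1 d2 d3 : ℕ)
    (hb : 0 < b) (hd1 : 0 < d1) (hd2 : 0 < d2) (hd3 : 0 < d3)
    (istar : Fin d1) (jstar : Fin d2) (kstar : Fin d3) :
    let Pr : Finset (BMMSamp s b d1 d2 d3) → ℝ :=
      fun E => (E.card : ℝ) / (Fintype.card (BMMSamp s b d1 d2 d3) : ℝ)
    let Ev : BMMIdx s b × BMMIdx s b × BMMIdx s b → Finset (BMMSamp s b d1 d2 d3) :=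
      fun u => Finset.univ.filter (fun ω =>
        ω.1 u.1 = istar ∧ ω.2.1 u.2.1 = jstar ∧ ω.2.2 u.2.2 = kstar)
    let T : Finset (BMMIdx s b × BMMIdx s b × BMMIdx s b) :=
      Finset.univ.filter (fun u => ∀ i, (u.1.1 i || u.2.1.1 i || u.2.2.1 i) = true)
    let μ : ℝ := ∑ u ∈ T, Pr (Ev u)
    let Δ : ℝ := ∑ p ∈ (T ×ˢ T).filter (fun p =>
        p.1 ≠ p.2 ∧ (p.1.1 = p.2.1 ∨ p.1.2.1 = p.2.2.1 ∨ p.1.2.2 = p.2.2.2)),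
      Pr (Ev p.1 ∩ Ev p.2)
    μ = (b : ℝ) ^ 3 * 7 ^ s / ((d1 : ℝ) * d2 * d3) ∧
      Δ ≤ (((d1 : ℝ) + d2 + d3) * (b : ℝ) ^ 5 * 25 ^ s +
            ((d1 : ℝ) * d2 + d1 * d3 + d2 * d3) * (b : ℝ) ^ 4 * 13 ^ s) /
          ((d1 : ℝ) * d2 * d3) ^ 2 := by
  intro Pr Ev T μ Δ
  have hT : T = trip s b := rfl
  have hPr : ∀ u v, Pr (Ev u ∩ Ev v) = _ := fun u v =>
    samp_count s b d1 d2 d3 hd1 hd2 hd3 istar jstar kstar u v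
  have h1 : (0 : ℝ) < d1 := by exact_mod_cast hd1
  have h2 : (0 : ℝ) < d2 := by exact_mod_cast hd2
  have h3 : (0 : ℝ) < d3 := by exact_mod_cast hd3
  constructor
  · have hu : ∀ u ∈ T, Pr (Ev u) = 1 / ((d1 : ℝ) * d2 * d3) := by
      intro u _
      have := hPr u u
      rw [Finset.inter_self] at this
      rw [this]
      simp
      ring
    show ∑ u ∈ T, Pr (Ev u) = _
    rw [Finset.sum_congr rfl hu, Finset.sum_const, hT, trip_card]
    simp only [nsmul_eq_mul]
    push_cast
    ring
  · have hΔ : Δ = ∑ p ∈ (T ×ˢ T).filter (fun p =>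
        p.1 ≠ p.2 ∧ (p.1.1 = p.2.1 ∨ p.1.2.1 = p.2.2.1 ∨ p.1.2.2 = p.2.2.2)),
      Pr (Ev p.1 ∩ Ev p.2) := rfl
    clear_value Δ μ T Pr Ev
    rw [hΔ, hT]
    set D : ℝ := ((d1 : ℝ) * d2 * d3) ^ 2 with hD
    have hDp : 0 < D := by positivity
    have key : ∀ u v : BMMIdx s b × BMMIdx s b × BMMIdx s b,
        (u ≠ v ∧ (u.1 = v.1 ∨ u.2.1 = v.2.1 ∨ u.2.2 = v.2.2)) → Pr (Ev u ∩ Ev v) ≤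
        (if u.1 = v.1 then d1 / D else 0) + (if u.2.1 = v.2.1 then d2 / D else 0) +
        (if u.2.2 = v.2.2 then d3 / D else 0) +
        (if u.1 = v.1 ∧ u.2.1 = v.2.1 then d1 * d2 / D else 0) +
        (if u.1 = v.1 ∧ u.2.2 = v.2.2 then d1 * d3 / D else 0) +
        (if u.2.1 = v.2.1 ∧ u.2.2 = v.2.2 then d2 * d3 / D else 0) := by
      rintro u v ⟨hne, hor⟩
      rw [hPr]
      have p1 : 0 < d1 / D := by positivity
      have p2 : 0 < d2 / D := by positivity
      have p3 : 0 < d3 / D := by positivity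
      by_cases e1 : u.1 = v.1 <;> by_cases e2 : u.2.1 = v.2.1 <;> by_cases e3 : u.2.2 = v.2.2
      · exact absurd (Prod.ext e1 (Prod.ext e2 e3)) hne
      · have : 1 / (d1 : ℝ) * (1 / d2 * (1 / d3 ^ 2)) = d1 * d2 / D := by rw [hD]; field_simp
        simp only [e1, e2, e3, if_true, if_false, and_true, and_false, this]; linarith
      · have : 1 / (d1 : ℝ) * (1 / d2 ^ 2 * (1 / d3)) = d1 * d3 / D := by rw [hD]; field_simp
        simp only [e1, e2, e3, if_true, if_false, and_true, and_false, false_and, this]; linarith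
      · have : 1 / (d1 : ℝ) * (1 / d2 ^ 2 * (1 / d3 ^ 2)) = d1 / D := by rw [hD]; field_simp
        simp only [e1, e2, e3, if_true, if_false, and_true, and_false, false_and, this]; linarith
      · have : 1 / (d1 : ℝ) ^ 2 * (1 / d2 * (1 / d3)) = d2 * d3 / D := by rw [hD]; field_simp
        simp only [e1, e2, e3, if_true, if_false, and_true, and_false, false_and, this]; linarith
      · have : 1 / (d1 : ℝ) ^ 2 * (1 / d2 * (1 / d3 ^ 2)) = d2 / D := by rw [hD]; field_simp
        simp only [e1, e2, e3, if_true, if_false, and_true, and_false, false_and, this]; linarith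
      · have : 1 / (d1 : ℝ) ^ 2 * (1 / d2 ^ 2 * (1 / d3)) = d3 / D := by rw [hD]; field_simp
        simp only [e1, e2, e3, if_true, if_false, and_true, and_false, false_and, this]; linarith
      · tauto
    refine (Finset.sum_le_sum (fun p hp => key p.1 p.2 (Finset.mem_filter.1 hp).2)).trans ?_
    refine (Finset.sum_le_sum_of_subset_of_nonneg (Finset.filter_subset _ _)
      (fun p _ _ => by positivity)).trans ?_
    simp only [Finset.sum_add_distrib]
    simp only [← Finset.sum_filter, Finset.sum_const, nsmul_eq_mul]
    have qcx := mul_le_mul_of_nonneg_right (a := (d1 / D : ℝ))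
      (Nat.cast_le (α := ℝ).2 (cnt_cx s b)) (by positivity)
    have qcy := mul_le_mul_of_nonneg_right (a := (d2 / D : ℝ))
      (Nat.cast_le (α := ℝ).2 (cnt_cy s b)) (by positivity)
    have qcz := mul_le_mul_of_nonneg_right (a := (d3 / D : ℝ))
      (Nat.cast_le (α := ℝ).2 (cnt_cz s b)) (by positivity)
    have qcxy := mul_le_mul_of_nonneg_right (a := (d1 * d2 / D : ℝ))
      (Nat.cast_le (α := ℝ).2 (cnt_cxy s b)) (by positivity)
    have qcxz := mul_le_mul_of_nonneg_right (a := (d1 * d3 / D : ℝ))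
      (Nat.cast_le (α := ℝ).2 (cnt_cxz s b)) (by positivity)
    have qcyz := mul_le_mul_of_nonneg_right (a := (d2 * d3 / D : ℝ))
      (Nat.cast_le (α := ℝ).2 (cnt_cyz s b)) (by positivity)
    push_cast at qcx qcy qcz qcxy qcxz qcyz
    refine (add_le_add (add_le_add (add_le_add (add_le_add (add_le_add qcx qcy) qcz)
      qcxy) qcxz) qcyz).trans (le_of_eq ?_)
    ring
end

section
/- Let κ > 0 be a real number such that b^3 · 7^s / ψ3 − (ψ1 · b^5 · 25^s + ψ2 · b^4 · 13^s) / (2 ψ3^2) ≥ κ. Then for every integer r with 1 ≤ r ≤ κ, with probability at least 1 − e^{r−κ} (κ/r)^r over the random choice of f1, f2, f3, there exist r good triples (x_1,y_1,z_1), …, (x_r,y_r,z_r) whose second coordinates y_1, …, y_r are pairwise distinct. -/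
open scoped Classical

section Janson
set_option linter.unusedSectionVars false
variable {α β ι : Type*} [Fintype α] [Fintype β]

/-- weight of a random subset -/
noncomputable def jW (p : α → ℝ) (R : Finset α) : ℝ := ∏ e, if e ∈ R then p e else 1 - p e

/-- expectation over a random subset -/
noncomputable def jE (p : α → ℝ) (F : Finset α → ℝ) : ℝ := ∑ R : Finset α, jW p R * F R

theorem jsum_prod (a b : α → ℝ) :
    ∑ R : Finset α, ∏ e, (if e ∈ R then a e else b e) = ∏ e, (a e + b e) := by
  rw [Finset.prod_add, Finset.powerset_univ]
  refine Finset.sum_congr rfl fun R _ => ?_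
  rw [Finset.prod_ite]
  congr 1
  · refine Finset.prod_congr ?_ fun _ _ => rfl
    ext; simp
  · refine Finset.prod_congr ?_ fun _ _ => rfl
    ext; simp

theorem jW_sum (p : α → ℝ) : ∑ R : Finset α, jW p R = 1 := by
  unfold jW
  rw [jsum_prod]; simp

theorem jW_nonneg (p : α → ℝ) (h0 : ∀ e, 0 ≤ p e) (h1 : ∀ e, p e ≤ 1) (R : Finset α) :
    0 ≤ jW p R := by
  unfold jW
  refine Finset.prod_nonneg fun e _ => ?_
  split_ifs
  · exact h0 e
  · linarith [h1 e]

theorem jW_lattice (p : α → ℝ) (A B : Finset α) :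
    jW p A * jW p B = jW p (A ⊓ B) * jW p (A ⊔ B) := by
  unfold jW
  rw [← Finset.prod_mul_distrib, ← Finset.prod_mul_distrib]
  refine Finset.prod_congr rfl fun e _ => ?_
  by_cases hA : e ∈ A <;> by_cases hB : e ∈ B <;> simp [hA, hB, mul_comm]

theorem jE_mono (p : α → ℝ) (h0 : ∀ e, 0 ≤ p e) (h1 : ∀ e, p e ≤ 1) {F G : Finset α → ℝ}
    (h : ∀ R, F R ≤ G R) : jE p F ≤ jE p G :=
  Finset.sum_le_sum fun R _ => mul_le_mul_of_nonneg_left (h R) (jW_nonneg p h0 h1 R)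

theorem jE_harris (p : α → ℝ) (h0 : ∀ e, 0 ≤ p e) (h1 : ∀ e, p e ≤ 1) {F G : Finset α → ℝ}
    (hF : Monotone F) (hG : Antitone G) (hF0 : ∀ R, 0 ≤ F R) (hG1 : ∀ R, G R ≤ 1) :
    jE p (fun R => F R * G R) ≤ jE p F * jE p G := by
  have h := fkg (μ := jW p) (f := F) (g := fun R => 1 - G R) (fun R => jW_nonneg p h0 h1 R)
    (fun R => hF0 R) (fun R => sub_nonneg.2 (hG1 R)) hF
    (fun a b hab => by have := hG hab; simp only; linarith) (fun a b => (jW_lattice p a b).le)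
  rw [jW_sum, one_mul] at h
  have e1 : ∑ a, jW p a * (1 - G a) = 1 - jE p G := by
    simp only [mul_sub, mul_one, Finset.sum_sub_distrib, jW_sum, jE]
  have e2 : ∑ a, jW p a * (F a * (1 - G a)) = jE p F - jE p (fun R => F R * G R) := by
    simp only [mul_sub, mul_one, Finset.sum_sub_distrib, jE]
  rw [e1, e2] at h
  have : ∑ a, jW p a * F a = jE p F := rfl
  rw [this] at h
  linarith

theorem jE_coord (p : α → ℝ) (e : α) (F : Finset α → ℝ) (hF : ∀ R, F (insert e R) = F R) :
    jE p (fun R => if e ∈ R then F R else 0) = p e * jE p F := by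
  have hu : (Finset.univ : Finset (Finset α)) = (insert e (Finset.univ.erase e)).powerset := by
    rw [Finset.insert_erase (Finset.mem_univ e), Finset.powerset_univ]
  have hw : ∀ R : Finset α, jW p R = (if e ∈ R then p e else 1 - p e) *
      ∏ x ∈ Finset.univ.erase e, (if x ∈ R then p x else 1 - p x) := fun R => by
    unfold jW
    rw [Finset.mul_prod_erase Finset.univ (fun x => if x ∈ R then p x else 1 - p x)
      (Finset.mem_univ e)]
  unfold jE
  rw [hu, Finset.sum_powerset_insert (by simp), Finset.sum_powerset_insert (by simp),
    ← Finset.sum_add_distrib, ← Finset.sum_add_distrib, Finset.mul_sum]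
  refine Finset.sum_congr rfl fun R hR => ?_
  have he : e ∉ R := fun h => by
    have := Finset.mem_powerset.1 hR h
    simp at this
  have hi : ∏ x ∈ Finset.univ.erase e, (if x ∈ insert e R then p x else 1 - p x) =
     ∏ x ∈ Finset.univ.erase e, (if x ∈ R then p x else 1 - p x) := by
    refine Finset.prod_congr rfl fun x hx => ?_
    simp [Finset.ne_of_mem_erase hx]
  rw [hw R, hw (insert e R), hi, hF]
  simp only [he, if_false, Finset.mem_insert_self, if_true, hF]
  ring

theorem jE_indep (p : α → ℝ) (S : Finset α) (F : Finset α → ℝ)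
    (hF : ∀ e ∈ S, ∀ R, F (insert e R) = F R) :
    jE p (fun R => if S ⊆ R then F R else 0) = (∏ e ∈ S, p e) * jE p F := by
  induction S using Finset.induction_on with
  | empty => simp
  | insert a S ha ih =>
    rw [Finset.prod_insert ha, mul_assoc,
      ← ih (fun e he => hF e (Finset.mem_insert_of_mem he)), ← jE_coord]
    · congr 1; ext R
      simp only [Finset.insert_subset_iff]
      by_cases h1 : a ∈ R <;> by_cases h2 : S ⊆ R <;> simp [h1, h2]
    · intro R
      simp only [hF a (Finset.mem_insert_self _ _) R, Finset.subset_insert_iff_of_notMem ha]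

theorem jE_sub (p : α → ℝ) (S : Finset α) :
    jE p (fun R => if S ⊆ R then 1 else 0) = ∏ e ∈ S, p e := by
  rw [jE_indep p S (fun _ => 1) (fun _ _ _ => rfl)]
  simp [jE, jW_sum]

/-- indicator that no set of the family is contained -/
noncomputable def jN (S : ι → Finset α) (T : Finset ι) (R : Finset α) : ℝ :=
  if ∀ u ∈ T, ¬ S u ⊆ R then 1 else 0

theorem jN_anti (S : ι → Finset α) (T : Finset ι) : Antitone (jN S T) := by
  intro A B hAB
  unfold jN
  by_cases h : ∀ u ∈ T, ¬ S u ⊆ B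
  · have : ∀ u ∈ T, ¬ S u ⊆ A := fun u hu h' => h u hu (h'.trans hAB)
    rw [if_pos h, if_pos this]
  · rw [if_neg h]; split_ifs <;> norm_num

theorem jN_le (S : ι → Finset α) (T : Finset ι) (R) : jN S T R ≤ 1 := by
  unfold jN; split_ifs <;> norm_num

theorem jN_nonneg (S : ι → Finset α) (T : Finset ι) (R) : 0 ≤ jN S T R := by
  unfold jN; split_ifs <;> norm_num

theorem jE_nonneg (p : α → ℝ) (h0 : ∀ e, 0 ≤ p e) (h1 : ∀ e, p e ≤ 1) {F : Finset α → ℝ}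
    (h : ∀ R, 0 ≤ F R) : 0 ≤ jE p F :=
  Finset.sum_nonneg fun R _ => mul_nonneg (jW_nonneg p h0 h1 R) (h R)

theorem janson_step (p : α → ℝ) (h0 : ∀ e, 0 ≤ p e) (h1 : ∀ e, p e ≤ 1)
    (S : ι → Finset α) (D : ι → ι → ℝ) (hD0 : ∀ u v, 0 ≤ D u v)
    (hD : ∀ u v, u ≠ v → ¬ Disjoint (S u) (S v) → ∏ e ∈ S u ∪ S v, p e ≤ D u v)
    (T : Finset ι) (a : ι) (ha : a ∉ T) :
    jE p (jN S (insert a T)) ≤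
      jE p (jN S T) * Real.exp (-(∏ e ∈ S a, p e) + ∑ v ∈ T, D a v) := by
  set T1 := T.filter (fun v => ¬ Disjoint (S a) (S v)) with hT1
  set T0 := T.filter (fun v => Disjoint (S a) (S v)) with hT0
  set C := jE p (jN S T0) with hC
  set br := (∏ e ∈ S a, p e) - ∑ v ∈ T, D a v with hbr
  have hTC : jE p (jN S T) ≤ C := by
    refine jE_mono p h0 h1 fun R => ?_
    unfold jN
    by_cases h : ∀ u ∈ T, ¬ S u ⊆ R
    · have : ∀ u ∈ T0, ¬ S u ⊆ R := fun u hu => h u (Finset.mem_filter.1 hu).1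
      rw [if_pos h, if_pos this]
    · rw [if_neg h]; split_ifs <;> norm_num
  have hT' : 0 ≤ jE p (jN S T) := jE_nonneg p h0 h1 (jN_nonneg S T)
  -- the probability of A and none of T
  have split : jE p (jN S (insert a T)) =
      jE p (jN S T) - jE p (fun R => if S a ⊆ R then jN S T R else 0) := by
    unfold jE
    rw [← Finset.sum_sub_distrib]
    refine Finset.sum_congr rfl fun R _ => ?_
    rw [← mul_sub]; congr 1
    simp only [jN, Finset.forall_mem_insert]
    by_cases hA : S a ⊆ R <;> simp [hA]
  have main : br * C ≤ jE p (fun R => if S a ⊆ R then jN S T R else 0) := by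
    have i1 : jE p (fun R => if S a ⊆ R then jN S T0 R else 0) = (∏ e ∈ S a, p e) * C := by
      apply jE_indep
      intro e he R
      unfold jN
      congr 1
      apply propext
      refine forall₂_congr fun u hu => ?_
      have := (Finset.mem_filter.1 hu).2
      rw [Finset.subset_insert_iff_of_notMem (Finset.disjoint_left.1 this he)]
    have i2 : ∀ v ∈ T1, jE p (fun R => (if S a ∪ S v ⊆ R then 1 else 0) * jN S T0 R)
        ≤ D a v * C := by
      intro v hv
      have hv' := Finset.mem_filter.1 hv
      refine (jE_harris p h0 h1 ?_ (jN_anti S T0) ?_ (jN_le S T0)).trans ?_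
      · intro A B hAB
        by_cases h : S a ∪ S v ⊆ A
        · simp only [if_pos h, if_pos (h.trans hAB), le_refl]
        · simp only [if_neg h]; split_ifs <;> norm_num
      · intro R; split_ifs <;> norm_num
      · rw [jE_sub]
        refine mul_le_mul_of_nonneg_right (hD a v ?_ hv'.2) (jE_nonneg p h0 h1 (jN_nonneg S T0))
        rintro rfl; exact ha hv'.1
    have i3 : jE p (fun R => if S a ⊆ R then jN S T0 R else 0) -
        ∑ v ∈ T1, jE p (fun R => (if S a ∪ S v ⊆ R then 1 else 0) * jN S T0 R) ≤
        jE p (fun R => if S a ⊆ R then jN S T R else 0) := by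
      unfold jE
      rw [Finset.sum_comm, ← Finset.sum_sub_distrib]
      refine Finset.sum_le_sum fun R _ => ?_
      rw [← Finset.mul_sum, ← mul_sub]
      refine mul_le_mul_of_nonneg_left ?_ (jW_nonneg p h0 h1 R)
      beta_reduce
      have hnn : 0 ≤ ∑ v ∈ T1, (if S a ∪ S v ⊆ R then (1:ℝ) else 0) * jN S T0 R :=
        Finset.sum_nonneg fun v _ => mul_nonneg (by split_ifs <;> norm_num) (jN_nonneg _ _ _)
      by_cases hA : S a ⊆ R
      · rw [if_pos hA, if_pos hA]
        by_cases h0' : ∀ u ∈ T0, ¬ S u ⊆ R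
        · by_cases hT : ∀ u ∈ T, ¬ S u ⊆ R
          · have : jN S T R = 1 := if_pos hT
            rw [this]; linarith [jN_le S T0 R]
          · push Not at hT
            obtain ⟨v, hv, hvR⟩ := hT
            have hv1 : v ∈ T1 := by
              refine Finset.mem_filter.2 ⟨hv, fun hd => ?_⟩
              exact h0' v (Finset.mem_filter.2 ⟨hv, hd⟩) hvR
            have := Finset.single_le_sum (f := fun v =>
              (if S a ∪ S v ⊆ R then (1:ℝ) else 0) * jN S T0 R)
              (fun v _ => mul_nonneg (by split_ifs <;> norm_num) (jN_nonneg _ _ _)) hv1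
            simp only [if_pos (Finset.union_subset hA hvR), one_mul] at this
            have := jN_nonneg S T R
            linarith
        · have : jN S T0 R = 0 := if_neg h0'
          have := jN_nonneg S T R
          linarith
      · rw [if_neg hA, if_neg hA]; linarith
    have hC0 : 0 ≤ C := jE_nonneg p h0 h1 (jN_nonneg S T0)
    have i4 : ∑ v ∈ T1, D a v * C ≤ (∑ v ∈ T, D a v) * C := by
      rw [← Finset.sum_mul]
      refine mul_le_mul_of_nonneg_right ?_ hC0
      exact Finset.sum_le_sum_of_subset_of_nonneg (Finset.filter_subset _ _)
        fun _ _ _ => hD0 _ _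
    have i5 := Finset.sum_le_sum i2
    rw [i1] at i3
    rw [hbr, sub_mul]
    linarith
  have main2 : br * jE p (jN S T) ≤ jE p (fun R => if S a ⊆ R then jN S T R else 0) := by
    rcases le_total 0 br with h | h
    · exact (mul_le_mul_of_nonneg_left hTC h).trans main
    · refine (mul_nonpos_of_nonpos_of_nonneg h hT').trans (jE_nonneg p h0 h1 fun R => ?_)
      split_ifs
      · exact jN_nonneg _ _ _
      · exact le_rfl
  rw [split]
  have hexp := Real.add_one_le_exp (-br)
  have : -(∏ e ∈ S a, p e) + ∑ v ∈ T, D a v = -br := by rw [hbr]; ring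
  rw [this]
  nlinarith [mul_le_mul_of_nonneg_left hexp hT']

theorem janson (p : α → ℝ) (h0 : ∀ e, 0 ≤ p e) (h1 : ∀ e, p e ≤ 1)
    (S : ι → Finset α) (D : ι → ι → ℝ) (hD0 : ∀ u v, 0 ≤ D u v) (hDs : ∀ u v, D u v = D v u)
    (hD : ∀ u v, u ≠ v → ¬ Disjoint (S u) (S v) → ∏ e ∈ S u ∪ S v, p e ≤ D u v)
    (T : Finset ι) :
    jE p (jN S T) ≤
      Real.exp (-(∑ u ∈ T, ∏ e ∈ S u, p e) + (∑ u ∈ T, ∑ v ∈ T, D u v) / 2) := by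
  induction T using Finset.induction_on with
  | empty => simp [jE, jN, jW_sum]
  | insert a T ha ih =>
    refine (janson_step p h0 h1 S D hD0 hD T a ha).trans ?_
    refine (mul_le_mul_of_nonneg_right ih (Real.exp_nonneg _)).trans ?_
    rw [← Real.exp_add]
    apply Real.exp_le_exp.2
    rw [Finset.sum_insert ha, Finset.sum_insert ha, Finset.sum_insert ha]
    have : ∑ u ∈ T, ∑ v ∈ insert a T, D u v = ∑ u ∈ T, D a u + ∑ u ∈ T, ∑ v ∈ T, D u v := by
      rw [← Finset.sum_add_distrib]
      refine Finset.sum_congr rfl fun u _ => ?_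
      rw [Finset.sum_insert ha, hDs]
    rw [this]
    linarith [hD0 a a]

theorem jE_sum (p : α → ℝ) (p' : β → ℝ) (F : Finset (α ⊕ β) → ℝ) :
    jE (Sum.elim p p') F = jE p (fun A => jE p' (fun B => F (A.disjSum B))) := by
  unfold jE
  simp_rw [Finset.mul_sum]
  rw [← Fintype.sum_prod_type']
  refine Fintype.sum_equiv Finset.sumEquiv.toEquiv _ _ fun R => ?_
  have : F R = F (R.toLeft.disjSum R.toRight) := by rw [Finset.toLeft_disjSum_toRight]
  rw [this, ← mul_assoc]
  congr 1
  unfold jW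
  rw [Fintype.prod_sum_type]
  simp
  congr!

theorem jE_swap (p : α → ℝ) (p' : β → ℝ) (F : Finset α → Finset β → ℝ) :
    jE p (fun A => jE p' (fun B => F A B)) = jE p' (fun B => jE p (fun A => F A B)) := by
  unfold jE
  simp_rw [Finset.mul_sum]
  rw [Finset.sum_comm]
  refine Finset.sum_congr rfl fun _ _ => Finset.sum_congr rfl fun _ _ => by ring

theorem jE_fun [DecidableEq α] (d : ℕ) (hd : 0 < d) (i : Fin d) (G : Finset α → ℝ) :
    ∑ f : α → Fin d, G (Finset.univ.filter fun x => f x = i) =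
      (Fintype.card (α → Fin d) : ℝ) * jE (fun _ => 1 / (d:ℝ)) G := by
  rw [← Finset.sum_fiberwise (s := Finset.univ)
    (g := fun f : α → Fin d => Finset.univ.filter fun x => f x = i)]
  unfold jE
  rw [Finset.mul_sum]
  refine Finset.sum_congr rfl fun A _ => ?_
  have e1 : ∑ f ∈ Finset.univ.filter (fun f : α → Fin d =>
      (Finset.univ.filter fun x => f x = i) = A), G (Finset.univ.filter fun x => f x = i) =
      ∑ f ∈ Finset.univ.filter (fun f : α → Fin d =>
      (Finset.univ.filter fun x => f x = i) = A), G A :=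
    Finset.sum_congr rfl fun f hf => by rw [(Finset.mem_filter.1 hf).2]
  rw [e1, Finset.sum_const, nsmul_eq_mul, ← mul_assoc]
  congr 1
  have e2 : Finset.univ.filter (fun f : α → Fin d =>
      (Finset.univ.filter fun x => f x = i) = A) =
      Fintype.piFinset (fun x => if x ∈ A then ({i} : Finset (Fin d)) else Finset.univ.erase i) := by
    ext f
    simp only [Finset.mem_filter, Finset.mem_univ, true_and, Fintype.mem_piFinset, Finset.ext_iff]
    refine forall_congr' fun x => ?_
    by_cases h : x ∈ A <;> simp [h]
  rw [e2, Fintype.card_piFinset, Fintype.card_fun, Fintype.card_fin]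
  unfold jW
  push_cast
  rw [← Finset.card_univ, ← Finset.prod_const, ← Finset.prod_mul_distrib]
  refine Finset.prod_congr rfl fun x _ => ?_
  have : (d:ℝ) ≠ 0 := by positivity
  by_cases h : x ∈ A
  · simp [h, this]
  · simp only [h, if_false]
    rw [Finset.card_erase_of_mem (Finset.mem_univ i), Finset.card_univ, Fintype.card_fin,
      Nat.cast_sub hd]
    field_simp
    simp

theorem jE_thin [DecidableEq α] (t q : ℝ) (N : Finset α) :
    jE (fun _ => t) (fun B => q ^ (B ∩ N).card) =
      jE (fun _ => (1 - q) * t) (fun B => if Disjoint B N then 1 else 0) := by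
  have l : jE (fun _ => t) (fun B => q ^ (B ∩ N).card) =
      ∏ e : α, ((if e ∈ N then q * t else t) + (1 - t)) := by
    rw [← jsum_prod]
    refine Finset.sum_congr rfl fun B _ => ?_
    have : q ^ (B ∩ N).card = ∏ e : α, if e ∈ B ∩ N then q else 1 := by
      rw [Finset.prod_ite_mem]; simp
    beta_reduce
    rw [this, jW, ← Finset.prod_mul_distrib]
    refine Finset.prod_congr rfl fun e _ => ?_
    by_cases h : e ∈ B <;> by_cases h' : e ∈ N <;> simp [h, h', mul_comm]
  have r : jE (fun _ => (1 - q) * t) (fun B => if Disjoint B N then 1 else 0) =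
      ∏ e : α, ((if e ∈ N then 0 else (1 - q) * t) + (1 - (1 - q) * t)) := by
    rw [← jsum_prod]
    refine Finset.sum_congr rfl fun B _ => ?_
    have : (if Disjoint B N then (1:ℝ) else 0) = ∏ e : α, if e ∈ B ∧ e ∈ N then 0 else 1 := by
      by_cases hd : Disjoint B N
      · rw [if_pos hd, Finset.prod_eq_one]
        intro e _
        rw [if_neg]
        rintro ⟨h, h'⟩
        exact Finset.disjoint_left.1 hd h h'
      · rw [if_neg hd]
        rw [Finset.not_disjoint_iff] at hd
        obtain ⟨e, h⟩ := hd
        rw [Finset.prod_eq_zero (Finset.mem_univ e)]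
        simp [h]
    beta_reduce
    rw [this, jW, ← Finset.prod_mul_distrib]
    refine Finset.prod_congr rfl fun e _ => ?_
    by_cases h : e ∈ B <;> by_cases h' : e ∈ N <;> simp [h, h']
  rw [l, r]
  refine Finset.prod_congr rfl fun e _ => ?_
  split_ifs <;> ring

end Janson

section Count

theorem cnt_collapse {U A : Type*} [Fintype U] [Fintype A] [DecidableEq A] (f : U → A) (g : U → ℝ) :
    ∑ u, ∑ v, g u * g v * (if f u = f v then 1 else 0) =
      ∑ a, (∑ u, if f u = a then g u else 0) ^ 2 := by
  simp_rw [sq, Finset.sum_mul_sum]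
  rw [Finset.sum_comm]
  conv_rhs => rw [Finset.sum_comm]; enter [2, u]; rw [Finset.sum_comm]
  rw [Finset.sum_comm]
  refine Finset.sum_congr rfl fun u _ => Finset.sum_congr rfl fun v _ => ?_
  rw [Finset.sum_eq_single (f u)]
  · by_cases h : f u = f v
    · simp [h]
    · simp [h, Ne.symm h]
  · intro a _ ha
    simp [Ne.symm ha]
  · simp

/-- single-coordinate indicator -/
noncomputable def cntk (a b c : Bool) : ℝ := if (a || b || c) = true then 1 else 0

/-- indicator that the OR is all ones -/
noncomputable def cntL {s b : ℕ} (x y z : BMMIdx s b) : ℝ := ∏ i, cntk (x.1 i) (y.1 i) (z.1 i)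

theorem cntL_eq {s b : ℕ} (x y z : BMMIdx s b) :
    cntL x y z = if ∀ i, (x.1 i || y.1 i || z.1 i) = true then 1 else 0 := by
  unfold cntL
  by_cases h : ∀ i, (x.1 i || y.1 i || z.1 i) = true
  · rw [if_pos h]
    exact Finset.prod_eq_one fun i _ => if_pos (h i)
  · rw [if_neg h]
    push Not at h
    obtain ⟨i, hi⟩ := h
    exact Finset.prod_eq_zero (Finset.mem_univ i) (if_neg hi)

theorem cntL_swap12 {s b : ℕ} (x y z : BMMIdx s b) : cntL x y z = cntL y x z := by
  unfold cntL cntk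
  refine Finset.prod_congr rfl fun i _ => ?_
  rw [Bool.or_comm (x.1 i)]

theorem cntL_swap23 {s b : ℕ} (x y z : BMMIdx s b) : cntL x y z = cntL x z y := by
  unfold cntL cntk
  refine Finset.prod_congr rfl fun i _ => ?_
  rw [Bool.or_assoc, Bool.or_assoc, Bool.or_comm (y.1 i)]

theorem cnt_sum {s b : ℕ} (g : Fin s → Bool → ℝ) :
    ∑ x : BMMIdx s b, ∏ i, g i (x.1 i) = b * ∏ i, ∑ a, g i a := by
  rw [Fintype.sum_prod_type, Finset.prod_univ_sum, Fintype.piFinset_univ, Finset.mul_sum]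
  simp

theorem cnt1 {s b : ℕ} (x y : BMMIdx s b) :
    ∑ z : BMMIdx s b, cntL x y z = b * ∏ i, ∑ c, cntk (x.1 i) (y.1 i) c :=
  cnt_sum fun i c => cntk (x.1 i) (y.1 i) c

theorem cnt2 {s b : ℕ} (x : BMMIdx s b) :
    ∑ y : BMMIdx s b, ∑ z : BMMIdx s b, cntL x y z =
      b ^ 2 * ∏ i, ∑ a, ∑ c, cntk (x.1 i) a c := by
  simp_rw [cnt1]
  rw [← Finset.mul_sum, cnt_sum fun i a => ∑ c, cntk (x.1 i) a c]
  ring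

theorem cntA (s b : ℕ) :
    ∑ x : BMMIdx s b, ∑ y : BMMIdx s b, ∑ z : BMMIdx s b, cntL x y z = (b:ℝ) ^ 3 * 7 ^ s := by
  simp_rw [cnt2]
  rw [← Finset.mul_sum, cnt_sum fun _ e => ∑ a, ∑ c, cntk e a c]
  simp only [Fintype.sum_bool, cntk]
  norm_num
  ring

theorem cntB (s b : ℕ) :
    ∑ x : BMMIdx s b, (∑ y : BMMIdx s b, ∑ z : BMMIdx s b, cntL x y z) ^ 2 =
      (b:ℝ) ^ 5 * 25 ^ s := by
  simp_rw [cnt2, mul_pow, ← Finset.prod_pow]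
  rw [← Finset.mul_sum, cnt_sum fun _ e => (∑ a, ∑ c, cntk e a c) ^ 2]
  simp only [Fintype.sum_bool, cntk]
  norm_num
  ring

theorem cntC (s b : ℕ) :
    ∑ x : BMMIdx s b, ∑ y : BMMIdx s b, (∑ z : BMMIdx s b, cntL x y z) ^ 2 =
      (b:ℝ) ^ 4 * 13 ^ s := by
  simp_rw [cnt1, mul_pow, ← Finset.prod_pow, ← Finset.mul_sum]
  have : ∀ x : BMMIdx s b, ∑ y : BMMIdx s b, ∏ i, (∑ c, cntk (x.1 i) (y.1 i) c) ^ 2 =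
     b * ∏ i, ∑ a, (∑ c, cntk (x.1 i) a c) ^ 2 := fun x =>
    cnt_sum fun i a => (∑ c, cntk (x.1 i) a c) ^ 2
  simp_rw [this]
  rw [← Finset.mul_sum, cnt_sum fun _ e => ∑ a, (∑ c, cntk e a c) ^ 2]
  simp only [Fintype.sum_bool, cntk]
  norm_num
  ring

abbrev Trip (s b : ℕ) : Type := BMMIdx s b × BMMIdx s b × BMMIdx s b

noncomputable def cntG {s b : ℕ} (u : Trip s b) : ℝ := cntL u.1 u.2.1 u.2.2

theorem cntX (s b : ℕ) : ∑ u : Trip s b, ∑ v : Trip s b,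
    cntG u * cntG v * (if u.1 = v.1 then 1 else 0) = (b:ℝ) ^ 5 * 25 ^ s := by
  rw [cnt_collapse (fun u : Trip s b => u.1) cntG, ← cntB]
  refine Finset.sum_congr rfl fun a _ => ?_
  congr 1
  rw [Fintype.sum_prod_type, Finset.sum_eq_single a]
  · rw [Fintype.sum_prod_type]; simp [cntG]
  · intro x _ hx; simp [hx]
  · simp

theorem cntY (s b : ℕ) : ∑ u : Trip s b, ∑ v : Trip s b,
    cntG u * cntG v * (if u.2.1 = v.2.1 then 1 else 0) = (b:ℝ) ^ 5 * 25 ^ s := by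
  rw [cnt_collapse (fun u : Trip s b => u.2.1) cntG, ← cntB]
  refine Finset.sum_congr rfl fun a _ => ?_
  congr 1
  rw [Fintype.sum_prod_type]
  refine Finset.sum_congr rfl fun x _ => ?_
  rw [Fintype.sum_prod_type, Finset.sum_eq_single a]
  · simp [cntG, cntL_swap12 x a]
  · intro x _ hx; simp [hx]
  · simp

theorem cntZ (s b : ℕ) : ∑ u : Trip s b, ∑ v : Trip s b,
    cntG u * cntG v * (if u.2.2 = v.2.2 then 1 else 0) = (b:ℝ) ^ 5 * 25 ^ s := by
  rw [cnt_collapse (fun u : Trip s b => u.2.2) cntG, ← cntB]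
  refine Finset.sum_congr rfl fun a _ => ?_
  congr 1
  rw [Fintype.sum_prod_type]
  refine Finset.sum_congr rfl fun x _ => ?_
  rw [Fintype.sum_prod_type]
  refine Finset.sum_congr rfl fun y _ => ?_
  rw [Finset.sum_eq_single a]
  · simp [cntG, cntL_swap23 x y a, cntL_swap12 x a]
  · intro x _ hx; simp [hx]
  · simp

theorem cntXY (s b : ℕ) : ∑ u : Trip s b, ∑ v : Trip s b,
    cntG u * cntG v * (if (u.1, u.2.1) = (v.1, v.2.1) then 1 else 0) = (b:ℝ) ^ 4 * 13 ^ s := by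
  rw [cnt_collapse (fun u : Trip s b => (u.1, u.2.1)) cntG, ← cntC, Fintype.sum_prod_type]
  refine Finset.sum_congr rfl fun a _ => Finset.sum_congr rfl fun c _ => ?_
  congr 1
  rw [Fintype.sum_prod_type, Finset.sum_eq_single a]
  · rw [Fintype.sum_prod_type, Finset.sum_eq_single c]
    · simp [cntG]
    · intro x _ hx; simp [hx]
    · simp
  · intro x _ hx; simp [hx]
  · simp

theorem cntXZ (s b : ℕ) : ∑ u : Trip s b, ∑ v : Trip s b,
    cntG u * cntG v * (if (u.1, u.2.2) = (v.1, v.2.2) then 1 else 0) = (b:ℝ) ^ 4 * 13 ^ s := by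
  rw [cnt_collapse (fun u : Trip s b => (u.1, u.2.2)) cntG, ← cntC, Fintype.sum_prod_type]
  refine Finset.sum_congr rfl fun a _ => Finset.sum_congr rfl fun c _ => ?_
  congr 1
  rw [Fintype.sum_prod_type, Finset.sum_eq_single a]
  · rw [Fintype.sum_prod_type]
    refine Finset.sum_congr rfl fun y _ => ?_
    rw [Finset.sum_eq_single c]
    · simp [cntG, cntL_swap23 a y]
    · intro x _ hx; simp [hx]
    · simp
  · intro x _ hx; simp [hx]
  · simp

theorem cntYZ (s b : ℕ) : ∑ u : Trip s b, ∑ v : Trip s b,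
    cntG u * cntG v * (if (u.2.1, u.2.2) = (v.2.1, v.2.2) then 1 else 0) = (b:ℝ) ^ 4 * 13 ^ s := by
  rw [cnt_collapse (fun u : Trip s b => (u.2.1, u.2.2)) cntG, ← cntC, Fintype.sum_prod_type]
  refine Finset.sum_congr rfl fun a _ => Finset.sum_congr rfl fun c _ => ?_
  congr 1
  rw [Fintype.sum_prod_type]
  refine Finset.sum_congr rfl fun x _ => ?_
  rw [Finset.sum_eq_single (a, c)]
  · simp [cntG, cntL_swap12 x a, cntL_swap23 a x]
  · rintro ⟨y, z⟩ _ hx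
    rw [if_neg]
    simpa using hx
  · simp

end Count

section Main

/-- the vertex set of a triple -/
noncomputable def tS {s b : ℕ} (u : Trip s b) :
    Finset (BMMIdx s b ⊕ (BMMIdx s b ⊕ BMMIdx s b)) :=
  {Sum.inl u.1, Sum.inr (Sum.inl u.2.1), Sum.inr (Sum.inr u.2.2)}

/-- the triples with full OR -/
noncomputable def tT (s b : ℕ) : Finset (Trip s b) :=
  Finset.univ.filter fun u => ∀ i, (u.1.1 i || u.2.1.1 i || u.2.2.1 i) = true

/-- the second coordinates covered by `A` and `C` -/
noncomputable def tN {s b : ℕ} (A C : Finset (BMMIdx s b)) : Finset (BMMIdx s b) :=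
  Finset.univ.filter fun y => ∃ x ∈ A, ∃ z ∈ C, ∀ i, (x.1 i || y.1 i || z.1 i) = true

/-- pair bound -/
noncomputable def tD {s b : ℕ} (c p1 p2 p3 : ℝ) (u v : Trip s b) : ℝ :=
  c * (p1 * p2 ^ 2 * p3 ^ 2 * (if u.1 = v.1 then 1 else 0) +
    p1 ^ 2 * p2 * p3 ^ 2 * (if u.2.1 = v.2.1 then 1 else 0) +
    p1 ^ 2 * p2 ^ 2 * p3 * (if u.2.2 = v.2.2 then 1 else 0) +
    p1 * p2 * p3 ^ 2 * (if (u.1, u.2.1) = (v.1, v.2.1) then 1 else 0) +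
    p1 * p2 ^ 2 * p3 * (if (u.1, u.2.2) = (v.1, v.2.2) then 1 else 0) +
    p1 ^ 2 * p2 * p3 * (if (u.2.1, u.2.2) = (v.2.1, v.2.2) then 1 else 0))

theorem sum_tT {s b : ℕ} (F : Trip s b → ℝ) : ∑ u ∈ tT s b, F u = ∑ u, cntG u * F u := by
  unfold tT
  rw [Finset.sum_filter]
  refine Finset.sum_congr rfl fun u _ => ?_
  rw [cntG, cntL_eq]
  split_ifs <;> simp

theorem sum_tT_one (s b : ℕ) (t : ℝ) : ∑ u ∈ tT s b, t = (b:ℝ) ^ 3 * 7 ^ s * t := by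
  rw [sum_tT, ← Finset.sum_mul, ← cntA, Fintype.sum_prod_type]
  simp_rw [Fintype.sum_prod_type]
  rfl

theorem sum_tD (s b : ℕ) (c p1 p2 p3 : ℝ) :
    ∑ u ∈ tT s b, ∑ v ∈ tT s b, tD c p1 p2 p3 u v =
      c * ((p1 * p2 ^ 2 * p3 ^ 2 + p1 ^ 2 * p2 * p3 ^ 2 + p1 ^ 2 * p2 ^ 2 * p3) *
          ((b:ℝ) ^ 5 * 25 ^ s) +
        (p1 * p2 * p3 ^ 2 + p1 * p2 ^ 2 * p3 + p1 ^ 2 * p2 * p3) * ((b:ℝ) ^ 4 * 13 ^ s)) := by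
  have e : ∑ u ∈ tT s b, ∑ v ∈ tT s b, tD c p1 p2 p3 u v =
      c * (p1 * p2 ^ 2 * p3 ^ 2 * ((b:ℝ) ^ 5 * 25 ^ s) +
    p1 ^ 2 * p2 * p3 ^ 2 * ((b:ℝ) ^ 5 * 25 ^ s) +
    p1 ^ 2 * p2 ^ 2 * p3 * ((b:ℝ) ^ 5 * 25 ^ s) +
    p1 * p2 * p3 ^ 2 * ((b:ℝ) ^ 4 * 13 ^ s) +
    p1 * p2 ^ 2 * p3 * ((b:ℝ) ^ 4 * 13 ^ s) +
    p1 ^ 2 * p2 * p3 * ((b:ℝ) ^ 4 * 13 ^ s)) := by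
    rw [sum_tT]
    simp_rw [sum_tT]
    conv_rhs =>
      congr
      · skip
      · congr
        · congr
          · congr
            · congr
              · congr
                · rw [← cntX]
                · rw [← cntY]
              · rw [← cntZ]
            · rw [← cntXY]
          · rw [← cntXZ]
        · rw [← cntYZ]
    simp only [Finset.mul_sum, ← Finset.sum_add_distrib]
    refine Finset.sum_congr rfl fun u _ => Finset.sum_congr rfl fun v _ => ?_
    unfold tD
    ring
  rw [e]; ring

theorem tD_nonneg {s b : ℕ} {c p1 p2 p3 : ℝ} (hc : 0 ≤ c) (h1 : 0 ≤ p1) (h2 : 0 ≤ p2)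
    (h3 : 0 ≤ p3) (u v : Trip s b) : 0 ≤ tD c p1 p2 p3 u v := by
  unfold tD
  have : ∀ P : Prop, 0 ≤ (if P then (1:ℝ) else 0) := fun P => by split_ifs <;> norm_num
  refine mul_nonneg hc ?_
  refine add_nonneg (add_nonneg (add_nonneg (add_nonneg (add_nonneg ?_ ?_) ?_) ?_) ?_) ?_ <;>
  refine mul_nonneg (by positivity) ?_ <;> split_ifs <;> norm_num

theorem tD_symm {s b : ℕ} (c p1 p2 p3 : ℝ) (u v : Trip s b) :
    tD c p1 p2 p3 u v = tD c p1 p2 p3 v u := by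
  unfold tD
  simp only [eq_comm]

theorem tS_prod {s b : ℕ} (c p1 p2 p3 : ℝ) (u : Trip s b) :
    ∏ e ∈ tS u, Sum.elim (fun _ => p1) (Sum.elim (fun _ => c * p2) (fun _ => p3)) e =
      c * (p1 * p2 * p3) := by
  unfold tS
  rw [Finset.prod_insert (by simp), Finset.prod_insert (by simp), Finset.prod_singleton]
  simp
  ring

theorem tD_bound {s b : ℕ} {c p1 p2 p3 : ℝ} (hc : 0 ≤ c) (hc1 : c ≤ 1) (h1 : 0 ≤ p1)
    (h2 : 0 ≤ p2) (h3 : 0 ≤ p3) (u v : Trip s b) (huv : u ≠ v)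
    (hd : ¬ Disjoint (tS u) (tS v)) :
    ∏ e ∈ tS u ∪ tS v, Sum.elim (fun _ => p1) (Sum.elim (fun _ => c * p2) (fun _ => p3)) e ≤
      tD c p1 p2 p3 u v := by
  obtain ⟨x, y, z⟩ := u
  obtain ⟨x', y', z'⟩ := v
  have hcc : 0 ≤ c * (1 - c) := mul_nonneg hc (by linarith)
  by_cases hx : x = x' <;> by_cases hy : y = y' <;> by_cases hz : z = z'
  · exact absurd (by rw [hx, hy, hz]) huv
  · subst hx hy
    have : tS (x, y, z) ∪ tS (x, y, z') =
      {Sum.inl x, Sum.inr (Sum.inl y), Sum.inr (Sum.inr z), Sum.inr (Sum.inr z')} := by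
      ext e; simp [tS]
    rw [this]
    rw [Finset.prod_insert (by simp), Finset.prod_insert (by simp),
      Finset.prod_insert (by simp [hz]), Finset.prod_singleton]
    simp [tD, hz]
    have : 0 ≤ c * (p1 * p2 ^ 2 * p3 ^ 2 + p1 ^ 2 * p2 * p3 ^ 2) := by positivity
    nlinarith
  · subst hx hz
    have : tS (x, y, z) ∪ tS (x, y', z) =
      {Sum.inl x, Sum.inr (Sum.inl y), Sum.inr (Sum.inl y'), Sum.inr (Sum.inr z)} := by
      ext e; simp [tS]; tauto
    rw [this]
    rw [Finset.prod_insert (by simp), Finset.prod_insert (by simp [hy]),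
      Finset.prod_insert (by simp), Finset.prod_singleton]
    simp [tD, hy]
    have : 0 ≤ c * (p1 * p2 ^ 2 * p3 ^ 2 + p1 ^ 2 * p2 ^ 2 * p3) := by positivity
    have : 0 ≤ c * (1 - c) * (p1 * p2 ^ 2 * p3) := by positivity
    nlinarith
  · subst hx
    have : tS (x, y, z) ∪ tS (x, y', z') =
      {Sum.inl x, Sum.inr (Sum.inl y), Sum.inr (Sum.inl y'), Sum.inr (Sum.inr z),
        Sum.inr (Sum.inr z')} := by
      ext e; simp [tS]; tauto
    rw [this]
    rw [Finset.prod_insert (by simp), Finset.prod_insert (by simp [hy]),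
      Finset.prod_insert (by simp), Finset.prod_insert (by simp [hz]), Finset.prod_singleton]
    simp [tD, hy, hz]
    have : 0 ≤ c * (1 - c) * (p1 * p2 ^ 2 * p3 ^ 2) := by positivity
    nlinarith
  · subst hy hz
    have : tS (x, y, z) ∪ tS (x', y, z) =
      {Sum.inl x, Sum.inl x', Sum.inr (Sum.inl y), Sum.inr (Sum.inr z)} := by
      ext e; simp [tS]; tauto
    rw [this]
    rw [Finset.prod_insert (by simp [hx]), Finset.prod_insert (by simp),
      Finset.prod_insert (by simp), Finset.prod_singleton]
    simp [tD, hx]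
    have : 0 ≤ c * (p1 ^ 2 * p2 * p3 ^ 2 + p1 ^ 2 * p2 ^ 2 * p3) := by positivity
    nlinarith
  · subst hy
    have : tS (x, y, z) ∪ tS (x', y, z') =
      {Sum.inl x, Sum.inl x', Sum.inr (Sum.inl y), Sum.inr (Sum.inr z),
        Sum.inr (Sum.inr z')} := by
      ext e; simp [tS]; tauto
    rw [this]
    rw [Finset.prod_insert (by simp [hx]), Finset.prod_insert (by simp),
      Finset.prod_insert (by simp), Finset.prod_insert (by simp [hz]), Finset.prod_singleton]
    simp [tD, hx, hz]
    nlinarith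
  · subst hz
    have : tS (x, y, z) ∪ tS (x', y', z) =
      {Sum.inl x, Sum.inl x', Sum.inr (Sum.inl y), Sum.inr (Sum.inl y'),
        Sum.inr (Sum.inr z)} := by
      ext e; simp [tS]; tauto
    rw [this]
    rw [Finset.prod_insert (by simp [hx]), Finset.prod_insert (by simp),
      Finset.prod_insert (by simp [hy]), Finset.prod_insert (by simp), Finset.prod_singleton]
    simp [tD, hx, hy]
    have : 0 ≤ c * (1 - c) * (p1 ^ 2 * p2 ^ 2 * p3) := by positivity
    nlinarith
  · exfalso
    apply hd
    simp [tS, Ne.symm hx, Ne.symm hy, Ne.symm hz]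

theorem tN_iff {s b : ℕ} (A B C : Finset (BMMIdx s b)) :
    jN tS (tT s b) (A.disjSum (B.disjSum C)) = if Disjoint B (tN A C) then 1 else 0 := by
  unfold jN
  congr 1
  apply propext
  rw [Finset.disjoint_left]
  simp only [tT, tN, tS, Finset.mem_filter, Finset.mem_univ, true_and, Finset.insert_subset_iff,
    Finset.singleton_subset_iff, Finset.inl_mem_disjSum, Finset.inr_mem_disjSum]
  constructor
  · rintro h y hy ⟨x, hx, z, hz, hh⟩
    exact h (x, y, z) hh ⟨hx, hy, hz⟩
  · rintro h ⟨x, y, z⟩ hh ⟨hx, hy, hz⟩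
    exact h hy ⟨x, hx, z, hz, hh⟩

theorem core (s b d1 d2 d3 : ℕ)
    (hd1 : 0 < d1) (hd2 : 0 < d2) (hd3 : 0 < d3)
    (istar : Fin d1) (jstar : Fin d2) (kstar : Fin d3)
    (κ : ℝ)
    (hgap : (b : ℝ) ^ 3 * 7 ^ s / ((d1 : ℝ) * d2 * d3) -
        (((d1 : ℝ) + d2 + d3) * (b : ℝ) ^ 5 * 25 ^ s +
          ((d1 : ℝ) * d2 + d1 * d3 + d2 * d3) * (b : ℝ) ^ 4 * 13 ^ s) /
        (2 * ((d1 : ℝ) * d2 * d3) ^ 2) ≥ κ) (q : ℝ) (hq0 : 0 ≤ q) (hq1 : q ≤ 1) :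
    ∑ ω : BMMSamp s b d1 d2 d3, q ^ ((Finset.univ.filter fun y => ω.2.1 y = jstar) ∩
      tN (Finset.univ.filter fun x => ω.1 x = istar)
        (Finset.univ.filter fun z => ω.2.2 z = kstar)).card ≤
      (Fintype.card (BMMSamp s b d1 d2 d3) : ℝ) * Real.exp (-((1 - q) * κ)) := by
  have D1 : (1:ℝ) ≤ d1 := by exact_mod_cast hd1
  have D2 : (1:ℝ) ≤ d2 := by exact_mod_cast hd2
  have D3 : (1:ℝ) ≤ d3 := by exact_mod_cast hd3
  set p1 : ℝ := 1 / d1 with hp1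
  set p2 : ℝ := 1 / d2 with hp2
  set p3 : ℝ := 1 / d3 with hp3
  have P1 : 0 ≤ p1 := by positivity
  have P2 : 0 ≤ p2 := by positivity
  have P3 : 0 ≤ p3 := by positivity
  have Q1 : p1 ≤ 1 := by rw [hp1, div_le_one (by linarith)]; exact D1
  have Q2 : p2 ≤ 1 := by rw [hp2, div_le_one (by linarith)]; exact D2
  have Q3 : p3 ≤ 1 := by rw [hp3, div_le_one (by linarith)]; exact D3
  have hc0 : 0 ≤ 1 - q := by linarith
  have hc1 : 1 - q ≤ 1 := by linarith
  -- rewrite as an expectation over random subsets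
  have e1 : ∑ ω : BMMSamp s b d1 d2 d3, q ^ ((Finset.univ.filter fun y => ω.2.1 y = jstar) ∩
      tN (Finset.univ.filter fun x => ω.1 x = istar)
        (Finset.univ.filter fun z => ω.2.2 z = kstar)).card =
      (Fintype.card (BMMSamp s b d1 d2 d3) : ℝ) *
       jE (fun _ => p1) (fun A : Finset (BMMIdx s b) => jE (fun _ => p2) (fun B =>
        jE (fun _ => p3) (fun C => q ^ (B ∩ tN A C).card))) := by
    rw [Fintype.sum_prod_type]
    simp_rw [Fintype.sum_prod_type]
    have a3 : ∀ A B : Finset (BMMIdx s b), ∑ f : BMMIdx s b → Fin d3,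
        q ^ (B ∩ tN A (Finset.univ.filter fun z => f z = kstar)).card = _ := fun A B =>
      jE_fun d3 hd3 kstar (fun C => q ^ (B ∩ tN A C).card)
    simp_rw [a3, ← Finset.mul_sum]
    have a2 : ∀ A : Finset (BMMIdx s b), ∑ f : BMMIdx s b → Fin d2,
        jE (fun _ => 1 / (d3:ℝ)) (fun C =>
          q ^ ((Finset.univ.filter fun y => f y = jstar) ∩ tN A C).card) = _ := fun A =>
      jE_fun d2 hd2 jstar (fun B => jE (fun _ => 1 / (d3:ℝ)) (fun C => q ^ (B ∩ tN A C).card))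
    simp_rw [a2, ← Finset.mul_sum]
    have a1 := jE_fun d1 hd1 istar (fun A : Finset (BMMIdx s b) =>
      jE (fun _ => 1 / (d2:ℝ)) (fun B =>
        jE (fun _ => 1 / (d3:ℝ)) (fun C => q ^ (B ∩ tN A C).card)))
    rw [a1, Fintype.card_prod, Fintype.card_prod]
    push_cast
    ring
  have e2 : jE (fun _ => p1) (fun A : Finset (BMMIdx s b) => jE (fun _ => p2) (fun B =>
        jE (fun _ => p3) (fun C => q ^ (B ∩ tN A C).card))) =
      jE (Sum.elim (fun _ => p1) (Sum.elim (fun _ => (1 - q) * p2) (fun _ => p3)))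
        (jN tS (tT s b)) := by
    rw [jE_sum]
    congr 1; ext A
    rw [jE_sum]
    conv_lhs => rw [jE_swap]
    conv_rhs => rw [jE_swap]
    congr 1; ext C
    rw [jE_thin]
    congr 1; ext B
    rw [tN_iff]
  rw [e1, e2]
  refine mul_le_mul_of_nonneg_left ?_ (by positivity)
  refine (janson _ ?_ ?_ tS (tD (1 - q) p1 p2 p3) (tD_nonneg hc0 P1 P2 P3)
    (tD_symm _ _ _ _) (fun u v huv hd => by convert tD_bound hc0 hc1 P1 P2 P3 u v huv hd) (tT s b)).trans ?_
  · rintro (e | e | e) <;> simp only [Sum.elim_inl, Sum.elim_inr] <;> positivity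
  · rintro (e | e | e) <;> simp only [Sum.elim_inl, Sum.elim_inr]
    · exact Q1
    · exact mul_le_one₀ hc1 P2 Q2
    · exact Q3
  · apply Real.exp_le_exp.2
    simp_rw [tS_prod]
    rw [sum_tT_one, sum_tD]
    have : (b : ℝ) ^ 3 * 7 ^ s / ((d1 : ℝ) * d2 * d3) -
        (((d1 : ℝ) + d2 + d3) * (b : ℝ) ^ 5 * 25 ^ s +
          ((d1 : ℝ) * d2 + d1 * d3 + d2 * d3) * (b : ℝ) ^ 4 * 13 ^ s) /
        (2 * ((d1 : ℝ) * d2 * d3) ^ 2) =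
      (b:ℝ) ^ 3 * 7 ^ s * (p1 * p2 * p3) -
      ((p1 * p2 ^ 2 * p3 ^ 2 + p1 ^ 2 * p2 * p3 ^ 2 + p1 ^ 2 * p2 ^ 2 * p3) *
          ((b:ℝ) ^ 5 * 25 ^ s) +
        (p1 * p2 * p3 ^ 2 + p1 * p2 ^ 2 * p3 + p1 ^ 2 * p2 * p3) * ((b:ℝ) ^ 4 * 13 ^ s)) / 2 := by
      have : (d1:ℝ) ≠ 0 := by positivity
      have : (d2:ℝ) ≠ 0 := by positivity
      have : (d3:ℝ) ≠ 0 := by positivity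
      rw [hp1, hp2, hp3]
      field_simp
    rw [this] at hgap
    have := mul_le_mul_of_nonneg_left hgap hc0
    linarith

end Main

/-- If `b^3·7^s/ψ3 − (ψ1·b^5·25^s + ψ2·b^4·13^s)/(2ψ3^2) ≥ κ`, then for any integer
`1 ≤ r ≤ κ`, with probability at least `1 − e^{r−κ}(κ/r)^r` over the uniform choice of
`f1, f2, f3` there exist `r` good triples whose second coordinates are pairwise distinct. -/
theorem bmm_good_triples_distinct_y (s b d1 d2 d3 : ℕ)
    (hb : 0 < b) (hd1 : 0 < d1) (hd2 : 0 < d2) (hd3 : 0 < d3)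
    (istar : Fin d1) (jstar : Fin d2) (kstar : Fin d3)
    (κ : ℝ) (hκ : 0 < κ)
    (hgap : (b : ℝ) ^ 3 * 7 ^ s / ((d1 : ℝ) * d2 * d3) -
        (((d1 : ℝ) + d2 + d3) * (b : ℝ) ^ 5 * 25 ^ s +
          ((d1 : ℝ) * d2 + d1 * d3 + d2 * d3) * (b : ℝ) ^ 4 * 13 ^ s) /
        (2 * ((d1 : ℝ) * d2 * d3) ^ 2) ≥ κ)
    (r : ℕ) (hr : 1 ≤ r) (hrκ : (r : ℝ) ≤ κ) :
    let good : BMMSamp s b d1 d2 d3 → BMMIdx s b × BMMIdx s b × BMMIdx s b → Prop :=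
      fun ω u => ω.1 u.1 = istar ∧ ω.2.1 u.2.1 = jstar ∧ ω.2.2 u.2.2 = kstar ∧
        ∀ i, (u.1.1 i || u.2.1.1 i || u.2.2.1 i) = true
    ((Finset.univ.filter (fun ω : BMMSamp s b d1 d2 d3 =>
        ∃ g : Fin r → BMMIdx s b × BMMIdx s b × BMMIdx s b,
          (∀ l, good ω (g l)) ∧
          Function.Injective (fun l => (g l).2.1))).card : ℝ) /
      (Fintype.card (BMMSamp s b d1 d2 d3) : ℝ) ≥
        1 - Real.exp ((r : ℝ) - κ) * (κ / r) ^ r := by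
  intro good
  set q : ℝ := r / κ with hq
  have hr0 : (0:ℝ) < r := by exact_mod_cast hr
  have hq0 : 0 < q := by positivity
  have hq1 : q ≤ 1 := by rw [hq, div_le_one hκ]; exact hrκ
  have hcore := core s b d1 d2 d3 hd1 hd2 hd3 istar jstar kstar κ hgap q hq0.le hq1
  set Y : BMMSamp s b d1 d2 d3 → Finset (BMMIdx s b) := fun ω =>
    (Finset.univ.filter fun y => ω.2.1 y = jstar) ∩
      tN (Finset.univ.filter fun x => ω.1 x = istar)
        (Finset.univ.filter fun z => ω.2.2 z = kstar) with hY
  set P : BMMSamp s b d1 d2 d3 → Prop := fun ω =>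
    ∃ g : Fin r → BMMIdx s b × BMMIdx s b × BMMIdx s b,
          (∀ l, good ω (g l)) ∧ Function.Injective (fun l => (g l).2.1) with hP
  have hbad : ∀ ω, ¬ P ω → (Y ω).card < r := by
    intro ω hω
    by_contra hlt
    push Not at hlt
    apply hω
    obtain ⟨e⟩ : Nonempty (Fin r ↪ Y ω) := by
      apply Function.Embedding.nonempty_of_card_le
      simpa using hlt
    have hy : ∀ l, ∃ u : BMMIdx s b × BMMIdx s b × BMMIdx s b,
        good ω u ∧ u.2.1 = (e l : BMMIdx s b) := by
      intro l
      have h := (e l).2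
      simp only [Y, tN, Finset.mem_inter, Finset.mem_filter, Finset.mem_univ, true_and] at h
      obtain ⟨hj, x, hx, z, hz, hh⟩ := h
      exact ⟨(x, e l, z), ⟨hx, hj, hz, hh⟩, rfl⟩
    choose g hg hg2 using hy
    refine ⟨g, hg, fun l l' h => ?_⟩
    simp only [hg2] at h
    exact e.injective (Subtype.ext h)
  have hn : (0:ℝ) < Fintype.card (BMMSamp s b d1 d2 d3) := by
    have : Nonempty (BMMSamp s b d1 d2 d3) := ⟨(fun _ => istar, fun _ => jstar, fun _ => kstar)⟩
    exact_mod_cast Fintype.card_pos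
  have hcard : ((Finset.univ.filter P).card : ℝ) + ((Finset.univ.filter fun ω => ¬ P ω).card : ℝ) =
      Fintype.card (BMMSamp s b d1 d2 d3) := by
    rw [← Finset.card_univ, ← Finset.card_filter_add_card_filter_not (s := Finset.univ) P]
    push_cast
    rfl
  have hmark : ((Finset.univ.filter fun ω => ¬ P ω).card : ℝ) * q ^ r ≤
      ∑ ω : BMMSamp s b d1 d2 d3, q ^ (Y ω).card := by
    calc ((Finset.univ.filter fun ω => ¬ P ω).card : ℝ) * q ^ r
        = ∑ ω ∈ Finset.univ.filter (fun ω => ¬ P ω), q ^ r := by simp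
      _ ≤ ∑ ω ∈ Finset.univ.filter (fun ω => ¬ P ω), q ^ (Y ω).card :=
        Finset.sum_le_sum fun ω hω =>
          pow_le_pow_of_le_one hq0.le hq1 (hbad ω (Finset.mem_filter.1 hω).2).le
      _ ≤ _ := Finset.sum_le_sum_of_subset_of_nonneg (Finset.filter_subset _ _)
        fun _ _ _ => by positivity
  have hexp : -((1 - q) * κ) = (r:ℝ) - κ := by
    rw [hq]; field_simp; ring
  rw [hexp] at hcore
  have hinv : (κ / r) ^ r * q ^ r = 1 := by
    rw [← mul_pow, hq]
    have : κ / r * (r / κ) = 1 := by field_simp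
    rw [this, one_pow]
  have hfin : ((Finset.univ.filter fun ω => ¬ P ω).card : ℝ) ≤
      Fintype.card (BMMSamp s b d1 d2 d3) * (Real.exp ((r : ℝ) - κ) * (κ / r) ^ r) := by
    have h := mul_le_mul_of_nonneg_right (hmark.trans hcore)
      (show 0 ≤ (κ / r) ^ r by positivity)
    rw [mul_assoc, mul_comm (q ^ r), hinv, mul_one, mul_assoc] at h
    exact h
  rw [ge_iff_le, le_div_iff₀ hn]
  linarith
end

section
/- Let A be a d1×d3 Boolean matrix and B a d3×d2 Boolean matrix, and fix i*, j*, k* with A_{i* k*} = B_{k* j*} = 1. Let κ be a positive integer such that b^3 · 7^s / ψ3 − (ψ1 · b^5 · 25^s + ψ2 · b^4 · 13^s) / (2 ψ3^2) ≥ κ. Then, over the random choice of f1, f2, f3 and of the uniformly random m×m GF(2) matrix D (independent of the f's), the estimated entry satisfies Pr(C̃_{i* j*} = 0) ≤ 2^{−κ} + κ e^{−κ/2}. -/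
open scoped Classical

set_option synthInstance.maxSize 512
set_option maxHeartbeats 1000000

/-- The sample space for the three independent uniformly random functions
`f1, f2, f3` together with the independent uniformly random `GF(2)` matrix `D`. -/
abbrev BMMSampD (s b d1 d2 d3 : ℕ) : Type :=
  ((BMMIdx s b → Fin d1) × (BMMIdx s b → Fin d2) × (BMMIdx s b → Fin d3)) ×
    (BMMIdx s b → BMMIdx s b → ZMod 2)


namespace BMMProof

/-- product Bernoulli weight -/
noncomputable def wt {V : Type*} [Fintype V] (p : V → ℝ) (ω : V → Bool) : ℝ :=
  ∏ v, (if ω v = true then p v else 1 - p v)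

lemma wt_nonneg {V : Type*} [Fintype V] (p : V → ℝ) (h0 : ∀ v, 0 ≤ p v) (h1 : ∀ v, p v ≤ 1)
    (ω : V → Bool) : 0 ≤ wt p ω := by
  unfold wt
  refine Finset.prod_nonneg fun v _ => ?_
  split_ifs
  · exact h0 v
  · linarith [h1 v]

lemma wt_sum {V : Type*} [Fintype V] [DecidableEq V] (p : V → ℝ) : ∑ ω : V → Bool, wt p ω = 1 := by
  unfold wt
  have := Finset.prod_univ_sum (fun _ : V => (Finset.univ : Finset Bool))
    (fun v c => if c = true then p v else 1 - p v)
  rw [Fintype.piFinset_univ] at this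
  rw [← this]
  simp

lemma wt_supermod {V : Type*} [Fintype V] (p : V → ℝ) (a b : V → Bool) :
    wt p a * wt p b ≤ wt p (a ⊓ b) * wt p (a ⊔ b) := by
  unfold wt
  rw [← Finset.prod_mul_distrib, ← Finset.prod_mul_distrib]
  apply le_of_eq
  refine Finset.prod_congr rfl fun v _ => ?_
  have key : ∀ (c d : Bool) (q : ℝ),
      (if c = true then q else 1 - q) * (if d = true then q else 1 - q) =
      (if c ⊓ d = true then q else 1 - q) * (if c ⊔ d = true then q else 1 - q) := by
    intro c d q
    cases c <;> cases d <;> simp [mul_comm]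
  exact key (a v) (b v) (p v)

/-- Harris inequality: increasing versus decreasing. -/
lemma harris {V : Type*} [Fintype V] [DecidableEq V] (p : V → ℝ) (h0 : ∀ v, 0 ≤ p v) (h1 : ∀ v, p v ≤ 1)
    (f g : (V → Bool) → ℝ) (hf0 : ∀ ω, 0 ≤ f ω) (hf : Monotone f) (hg1 : ∀ ω, g ω ≤ 1)
    (hg : Antitone g) :
    ∑ ω, wt p ω * (f ω * g ω) ≤ (∑ ω, wt p ω * f ω) * ∑ ω, wt p ω * g ω := by
  have := fkg (α := V → Bool) (β := ℝ) (μ := wt p) (f := f) (g := fun ω => 1 - g ω)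
    (fun ω => wt_nonneg p h0 h1 ω) hf0
    (fun ω => by simpa using hg1 ω) hf
    (fun a b hab => by have := hg hab; simp only; linarith) (wt_supermod p)
  simp only [mul_sub, mul_one, Finset.sum_sub_distrib, wt_sum, one_mul] at this
  linarith

lemma wt_single {V : Type*} [Fintype V] [DecidableEq V] (p : V → ℝ) (v : V) (h : (V → Bool) → ℝ)
    (hh : ∀ ω c, h (Function.update ω v c) = h ω) :
    ∑ ω, wt p ω * ((if ω v = true then 1 else 0) * h ω) = p v * ∑ ω, wt p ω * h ω := by
  set A := ∑ ω, wt p ω * ((if ω v = true then 1 else 0) * h ω) with hA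
  set B := ∑ ω, wt p ω * ((if ω v = true then 0 else 1) * h ω) with hB
  have hAB : ∑ ω, wt p ω * h ω = A + B := by
    rw [hA, hB, ← Finset.sum_add_distrib]
    refine Finset.sum_congr rfl fun ω _ => ?_
    split_ifs <;> ring
  have hrest : ∀ ω : V → Bool, ∀ c, wt p (Function.update ω v c) =
      (if c = true then p v else 1 - p v) *
        ∏ u ∈ Finset.univ.erase v, (if ω u = true then p u else 1 - p u) := by
    intro ω c
    unfold wt
    rw [← Finset.mul_prod_erase _ _ (Finset.mem_univ v)]
    simp only [Function.update_self]
    congr 1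
    refine Finset.prod_congr rfl fun u hu => ?_
    rw [Function.update_of_ne (Finset.ne_of_mem_erase hu)]
  have key : (1 - p v) * A = p v * B := by
    rw [hA, hB, Finset.mul_sum, Finset.mul_sum]
    let e : (V → Bool) → (V → Bool) := fun ω => Function.update ω v (!(ω v))
    have he : Function.Involutive e := by
      intro ω
      simp [e]
    refine Fintype.sum_equiv (he.toPerm e) _ _ fun ω => ?_
    have h1 : wt p ω = wt p (Function.update ω v (ω v)) := by simp
    have h2 : (he.toPerm e) ω = Function.update ω v (!(ω v)) := rfl
    rw [h2, h1, hrest, hrest, hh]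
    cases hv : ω v <;> simp
    ring
  rw [hAB]
  linarith

/-- all of `S` is switched on -/
noncomputable def onI {V : Type*} (S : Finset V) (ω : V → Bool) : ℝ :=
  if ∀ v ∈ S, ω v = true then 1 else 0

lemma onI_nonneg {V : Type*} (S : Finset V) (ω : V → Bool) : 0 ≤ onI S ω := by
  unfold onI; split_ifs <;> norm_num

lemma onI_le {V : Type*} (S : Finset V) (ω : V → Bool) : onI S ω ≤ 1 := by
  unfold onI; split_ifs <;> norm_num

lemma onI_mono {V : Type*} (S : Finset V) : Monotone (onI S) := by
  intro a b hab
  unfold onI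
  by_cases h : ∀ v ∈ S, a v = true
  · have : ∀ v ∈ S, b v = true := fun v hv => by
      have h1 := hab v
      rw [h v hv] at h1
      exact (Bool.eq_true_of_true_le h1)
    rw [if_pos h, if_pos this]
  · rw [if_neg h]
    split_ifs <;> norm_num

lemma onI_mul {V : Type*} [DecidableEq V] (S T : Finset V) (ω : V → Bool) :
    onI S ω * onI T ω = onI (S ∪ T) ω := by
  unfold onI
  by_cases h : ∀ v ∈ S, ω v = true <;> by_cases h' : ∀ v ∈ T, ω v = true
  · rw [if_pos h, if_pos h', if_pos]; · norm_num
    intro v hv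
    rcases Finset.mem_union.1 hv with hv | hv
    · exact h v hv
    · exact h' v hv
  · rw [if_neg h', if_neg (c := ∀ v ∈ S ∪ T, ω v = true) (fun H => h' fun v hv => H v (Finset.mem_union_right _ hv))]; simp
  · rw [if_neg h, if_neg (c := ∀ v ∈ S ∪ T, ω v = true) (fun H => h fun v hv => H v (Finset.mem_union_left _ hv))]; simp
  · rw [if_neg h, if_neg (c := ∀ v ∈ S ∪ T, ω v = true) (fun H => h fun v hv => H v (Finset.mem_union_left _ hv))]; simp

lemma wt_on {V : Type*} [Fintype V] [DecidableEq V] (p : V → ℝ) (S : Finset V) (h : (V → Bool) → ℝ)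
    (hh : ∀ v ∈ S, ∀ ω c, h (Function.update ω v c) = h ω) :
    ∑ ω, wt p ω * (onI S ω * h ω) = (∏ v ∈ S, p v) * ∑ ω, wt p ω * h ω := by
  induction S using Finset.induction_on with
  | empty => simp [onI]
  | insert a S ha ih =>
    have e1 : ∀ ω, onI (insert a S) ω * h ω = (if ω a = true then 1 else 0) * (onI S ω * h ω) := by
      intro ω
      rw [Finset.insert_eq, ← onI_mul]
      simp [onI]
    simp only [e1]
    rw [wt_single, ih, Finset.prod_insert ha, mul_assoc]
    · intro v hv; exact hh v (Finset.mem_insert_of_mem hv)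
    · intro ω c
      rw [hh a (Finset.mem_insert_self _ _)]
      congr 1
      unfold onI
      congr 1
      apply propext
      refine forall₂_congr fun v hv => ?_
      rw [Function.update_of_ne]
      rintro rfl; exact ha hv

/-- none of the sets `S t`, `t ∈ T`, is switched on -/
noncomputable def noI {V ι : Type*} (S : ι → Finset V) (T : Finset ι) (ω : V → Bool) : ℝ :=
  if ∀ t ∈ T, ¬ ∀ v ∈ S t, ω v = true then 1 else 0

lemma noI_nonneg {V ι : Type*} (S : ι → Finset V) (T : Finset ι) (ω : V → Bool) :
    0 ≤ noI S T ω := by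
  unfold noI; split_ifs <;> norm_num

lemma noI_le {V ι : Type*} (S : ι → Finset V) (T : Finset ι) (ω : V → Bool) :
    noI S T ω ≤ 1 := by
  unfold noI; split_ifs <;> norm_num

lemma noI_anti {V ι : Type*} (S : ι → Finset V) (T : Finset ι) : Antitone (noI S T) := by
  intro a b hab
  unfold noI
  by_cases h : ∀ t ∈ T, ¬ ∀ v ∈ S t, b v = true
  · have : ∀ t ∈ T, ¬ ∀ v ∈ S t, a v = true := by
      intro t ht H
      refine h t ht fun v hv => ?_
      have h1 := hab v
      rw [H v hv] at h1
      exact (Bool.eq_true_of_true_le h1)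
    rw [if_pos h, if_pos this]
  · rw [if_neg h]
    split_ifs <;> norm_num

lemma noI_insert {V ι : Type*} [DecidableEq ι] (S : ι → Finset V) (T : Finset ι) (i : ι) (ω : V → Bool) :
    noI S (insert i T) ω = noI S T ω - onI (S i) ω * noI S T ω := by
  unfold noI onI
  by_cases h1 : ∀ v ∈ S i, ω v = true <;>
    by_cases h2 : ∀ t ∈ T, ¬ ∀ v ∈ S t, ω v = true
  · rw [if_pos h1, if_pos h2, if_neg]; · norm_num
    intro H; exact H i (Finset.mem_insert_self _ _) h1
  · rw [if_neg h2, if_neg]; · norm_num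
    intro H; exact h2 fun t ht => H t (Finset.mem_insert_of_mem ht)
  · rw [if_neg h1, if_pos h2, if_pos]; · norm_num
    intro t ht
    rcases Finset.mem_insert.1 ht with rfl | ht
    · exact h1
    · exact h2 t ht
  · rw [if_neg h2, if_neg]; · norm_num
    intro H; exact h2 fun t ht => H t (Finset.mem_insert_of_mem ht)

lemma noI_split {V ι : Type*} [DecidableEq V] (S : ι → Finset V) (T : Finset ι) (i : ι) (ω : V → Bool) :
    noI S (T.filter fun u => Disjoint (S i) (S u)) ω -
      ∑ u ∈ T.filter (fun u => ¬ Disjoint (S i) (S u)),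
        onI (S u) ω * noI S (T.filter fun u => Disjoint (S i) (S u)) ω ≤ noI S T ω := by
  have hs : ∀ u ∈ T.filter (fun u => ¬ Disjoint (S i) (S u)),
      0 ≤ onI (S u) ω * noI S (T.filter fun u => Disjoint (S i) (S u)) ω :=
    fun u _ => mul_nonneg (onI_nonneg _ _) (noI_nonneg _ _ _)
  by_cases hT : ∀ t ∈ T, ¬ ∀ v ∈ S t, ω v = true
  · have : noI S T ω = 1 := if_pos hT
    rw [this]
    have := Finset.sum_nonneg hs
    linarith [noI_le S (T.filter fun u => Disjoint (S i) (S u)) ω]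
  · have h0 : noI S T ω = 0 := if_neg hT
    rw [h0]
    push Not at hT
    obtain ⟨t, ht, hv⟩ := hT
    by_cases hd : Disjoint (S i) (S t)
    · have : noI S (T.filter fun u => Disjoint (S i) (S u)) ω = 0 := by
        apply if_neg
        intro H
        exact H t (Finset.mem_filter.2 ⟨ht, hd⟩) hv
      rw [this]; simp
    · have h1 : onI (S t) ω = 1 := if_pos hv
      have := Finset.single_le_sum hs (Finset.mem_filter.2 ⟨ht, hd⟩)
      rw [h1, one_mul] at this
      linarith

/-- Janson's inequality. -/
theorem janson {V ι : Type*} [Fintype V] [DecidableEq V] [DecidableEq ι] (p : V → ℝ) (h0 : ∀ v, 0 ≤ p v) (h1 : ∀ v, p v ≤ 1)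
    (S : ι → Finset V) (T : Finset ι) :
    ∑ ω, wt p ω * noI S T ω ≤ Real.exp (-(∑ t ∈ T, ∏ v ∈ S t, p v) +
      (∑ t ∈ T, ∑ u ∈ T, if t ≠ u ∧ ¬ Disjoint (S t) (S u) then ∏ v ∈ S t ∪ S u, p v else 0) / 2)
    := by
  induction T using Finset.induction_on with
  | empty => simp [noI, wt_sum]
  | insert i T hi ih =>
    set P := ∑ ω, wt p ω * noI S T ω with hP
    set T' := T.filter (fun u => Disjoint (S i) (S u)) with hT'
    set T'' := T.filter (fun u => ¬ Disjoint (S i) (S u)) with hT''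
    set M := ∑ ω, wt p ω * noI S T' ω with hM
    set c := ∏ v ∈ S i, p v - ∑ u ∈ T'', ∏ v ∈ S i ∪ S u, p v with hc
    have hwn := wt_nonneg p h0 h1
    have hP0 : 0 ≤ P := Finset.sum_nonneg fun ω _ => mul_nonneg (hwn ω) (noI_nonneg _ _ _)
    have hPM : P ≤ M := by
      refine Finset.sum_le_sum fun ω _ => mul_le_mul_of_nonneg_left ?_ (hwn ω)
      unfold noI
      by_cases h : ∀ t ∈ T, ¬ ∀ v ∈ S t, ω v = true
      · rw [if_pos h, if_pos fun t ht => h t (Finset.mem_filter.1 ht).1]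
      · rw [if_neg h]; split_ifs <;> norm_num
    have hind : ∑ ω, wt p ω * (onI (S i) ω * noI S T' ω) = (∏ v ∈ S i, p v) * M := by
      apply wt_on
      intro v hv ω x
      unfold noI
      congr 1
      apply propext
      refine forall₂_congr fun t ht => not_congr (forall₂_congr fun u hu => ?_)
      rw [Function.update_of_ne]
      rintro rfl
      exact (Finset.disjoint_left.1 (Finset.mem_filter.1 ht).2 hv) hu
    have hon : ∀ R : Finset V, ∑ ω, wt p ω * onI R ω = ∏ v ∈ R, p v := by
      intro R
      have := wt_on p R (fun _ => 1) (fun _ _ _ _ => rfl)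
      simpa [wt_sum] using this
    have hbound : c * M ≤ ∑ ω, wt p ω * (onI (S i) ω * noI S T ω) := by
      calc c * M ≤ (∑ ω, wt p ω * (onI (S i) ω * noI S T' ω)) -
            ∑ u ∈ T'', ∑ ω, wt p ω * (onI (S i ∪ S u) ω * noI S T' ω) := by
              rw [hind, hc, sub_mul, Finset.sum_mul]
              refine sub_le_sub_left (Finset.sum_le_sum fun u _ => ?_) _
              have := harris p h0 h1 (onI (S i ∪ S u)) (noI S T') (onI_nonneg _) (onI_mono _)
                (noI_le _ _) (noI_anti _ _)
              rwa [hon] at this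
        _ = ∑ ω, wt p ω * (onI (S i) ω * (noI S T' ω - ∑ u ∈ T'', onI (S u) ω * noI S T' ω)) := by
              rw [Finset.sum_comm, ← Finset.sum_sub_distrib]
              refine Finset.sum_congr rfl fun ω _ => ?_
              rw [mul_sub, mul_sub, Finset.mul_sum, Finset.mul_sum]
              congr 1
              refine Finset.sum_congr rfl fun u _ => ?_
              rw [← onI_mul]; ring
        _ ≤ _ := by
              refine Finset.sum_le_sum fun ω _ => mul_le_mul_of_nonneg_left ?_ (hwn ω)
              exact mul_le_mul_of_nonneg_left (noI_split S T i ω) (onI_nonneg _ _)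
    have hbound2 : c * P ≤ ∑ ω, wt p ω * (onI (S i) ω * noI S T ω) := by
      rcases le_total 0 c with h | h
      · exact (mul_le_mul_of_nonneg_left hPM h).trans hbound
      · refine (mul_nonpos_of_nonpos_of_nonneg h hP0).trans ?_
        exact Finset.sum_nonneg fun ω _ =>
          mul_nonneg (hwn ω) (mul_nonneg (onI_nonneg _ _) (noI_nonneg _ _ _))
    have hstep : ∑ ω, wt p ω * noI S (insert i T) ω ≤ Real.exp (-c) * P := by
      simp only [noI_insert, mul_sub, Finset.sum_sub_distrib]
      have := mul_le_mul_of_nonneg_right (Real.add_one_le_exp (-c)) hP0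
      linarith
    refine hstep.trans ((mul_le_mul_of_nonneg_left ih (Real.exp_pos _).le).trans ?_)
    rw [← Real.exp_add]
    apply Real.exp_le_exp.2
    apply le_of_eq
    have hA : ∑ u ∈ T, (if i ≠ u ∧ ¬ Disjoint (S i) (S u) then ∏ v ∈ S i ∪ S u, p v else 0) =
        ∑ u ∈ T'', ∏ v ∈ S i ∪ S u, p v := by
      rw [hT'', Finset.sum_filter]
      refine Finset.sum_congr rfl fun u hu => ?_
      have : i ≠ u := by rintro rfl; exact hi hu
      simp [this]
    have hB : ∑ u ∈ T, (if u ≠ i ∧ ¬ Disjoint (S u) (S i) then ∏ v ∈ S u ∪ S i, p v else 0) =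
        ∑ u ∈ T'', ∏ v ∈ S i ∪ S u, p v := by
      rw [← hA]
      refine Finset.sum_congr rfl fun u hu => ?_
      rw [Finset.union_comm]
      simp only [ne_comm (a := u) (b := i), disjoint_comm (a := S u) (b := S i)]
    rw [Finset.sum_insert hi, Finset.sum_insert hi, Finset.sum_insert hi]
    have hC : ∀ t ∈ T, ∑ u ∈ insert i T, (if t ≠ u ∧ ¬ Disjoint (S t) (S u) then
        ∏ v ∈ S t ∪ S u, p v else 0) = (if t ≠ i ∧ ¬ Disjoint (S t) (S i) then
        ∏ v ∈ S t ∪ S i, p v else 0) + ∑ u ∈ T, (if t ≠ u ∧ ¬ Disjoint (S t) (S u) then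
        ∏ v ∈ S t ∪ S u, p v else 0) := fun t _ => Finset.sum_insert hi
    rw [Finset.sum_congr rfl hC, Finset.sum_add_distrib, hB, hA]
    simp only [ne_eq, not_true_eq_false, false_and, if_false]
    rw [hc]
    ring

/-- the OR condition -/
def ok {s b : ℕ} (x y z : BMMIdx s b) : Prop := ∀ l, (x.1 l || y.1 l || z.1 l) = true

noncomputable def okI {s b : ℕ} (x y z : BMMIdx s b) : ℝ := if ok x y z then 1 else 0

noncomputable def bt (x y z : Bool) : ℝ := if (x || y || z) = true then 1 else 0

lemma okI_prod {s b : ℕ} (x y z : BMMIdx s b) : okI x y z = ∏ l, bt (x.1 l) (y.1 l) (z.1 l) := by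
  unfold okI bt ok
  rw [Finset.prod_ite_zero]
  simp

lemma okI_nonneg {s b : ℕ} (x y z : BMMIdx s b) : 0 ≤ okI x y z := by
  unfold okI; split_ifs <;> norm_num

lemma sum_idx {s b : ℕ} (G : Fin s → Bool → ℝ) :
    ∑ x : BMMIdx s b, ∏ l, G l (x.1 l) = b * ∏ l, ∑ c, G l c := by
  rw [Fintype.sum_prod_type]
  simp only [Finset.sum_const, Finset.card_univ, Fintype.card_fin, nsmul_eq_mul]
  rw [← Finset.mul_sum, Finset.prod_univ_sum, Fintype.piFinset_univ]

lemma okI_symm12 {s b : ℕ} (x y z : BMMIdx s b) : okI x y z = okI y x z := by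
  unfold okI ok
  congr 1
  apply propext
  refine forall_congr' fun l => ?_
  rw [Bool.or_comm (x.1 l) (y.1 l)]

lemma okI_symm23 {s b : ℕ} (x y z : BMMIdx s b) : okI x y z = okI x z y := by
  unfold okI ok
  congr 1
  apply propext
  refine forall_congr' fun l => ?_
  rw [Bool.or_assoc, Bool.or_assoc, Bool.or_comm (y.1 l) (z.1 l)]

lemma sum_z {s b : ℕ} (x y : BMMIdx s b) :
    ∑ z, okI x y z = b * ∏ l, ∑ c, bt (x.1 l) (y.1 l) c := by
  simp only [okI_prod]
  exact sum_idx fun l c => bt (x.1 l) (y.1 l) c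

lemma sum_yz {s b : ℕ} (x : BMMIdx s b) :
    ∑ y, ∑ z, okI x y z = b ^ 2 * ∏ l, ∑ d, ∑ c, bt (x.1 l) d c := by
  simp only [sum_z]
  rw [← Finset.mul_sum, sum_idx (fun l d => ∑ c, bt (x.1 l) d c)]
  ring

lemma cnt7 {s b : ℕ} : ∑ x : BMMIdx s b, ∑ y, ∑ z, okI x y z = b ^ 3 * 7 ^ s := by
  simp only [sum_yz]
  rw [← Finset.mul_sum, sum_idx (fun l e => ∑ d, ∑ c, bt e d c)]
  simp only [Fintype.sum_bool, bt, Bool.or_true, Bool.true_or, Bool.or_false, if_true,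
    Bool.false_eq_true, if_false, Finset.prod_const, Finset.card_univ, Fintype.card_fin]
  norm_num
  ring

lemma cnt25 {s b : ℕ} : ∑ x : BMMIdx s b, (∑ y, ∑ z, okI x y z) ^ 2 = b ^ 5 * 25 ^ s := by
  simp only [sum_yz, mul_pow, ← Finset.prod_pow]
  rw [← Finset.mul_sum, sum_idx (fun l e => (∑ d, ∑ c, bt e d c) ^ 2)]
  simp only [Fintype.sum_bool, bt, Bool.or_true, Bool.true_or, Bool.or_false, if_true,
    Bool.false_eq_true, if_false, Finset.prod_const, Finset.card_univ, Fintype.card_fin]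
  norm_num
  ring

lemma cnt13 {s b : ℕ} : ∑ x : BMMIdx s b, ∑ y, (∑ z, okI x y z) ^ 2 = b ^ 4 * 13 ^ s := by
  simp only [sum_z, mul_pow, ← Finset.prod_pow]
  have : ∀ x : BMMIdx s b, ∑ y : BMMIdx s b, (b : ℝ) ^ 2 * ∏ l, (∑ c, bt (x.1 l) (y.1 l) c) ^ 2 =
      (b : ℝ) ^ 3 * ∏ l, ∑ d, (∑ c, bt (x.1 l) d c) ^ 2 := by
    intro x
    rw [← Finset.mul_sum, sum_idx (fun l d => (∑ c, bt (x.1 l) d c) ^ 2)]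
    ring
  simp only [this]
  rw [← Finset.mul_sum, sum_idx (fun l e => ∑ d, (∑ c, bt e d c) ^ 2)]
  simp only [Fintype.sum_bool, bt, Bool.or_true, Bool.true_or, Bool.or_false, if_true,
    Bool.false_eq_true, if_false, Finset.prod_const, Finset.card_univ, Fintype.card_fin]
  norm_num
  ring

/-- six-fold sum over ordered pairs of triples -/
noncomputable def S6 {s b : ℕ} (F : BMMIdx s b → BMMIdx s b → BMMIdx s b →
    BMMIdx s b → BMMIdx s b → BMMIdx s b → ℝ) : ℝ :=
  ∑ x, ∑ y, ∑ z, ∑ x', ∑ y', ∑ z', okI x y z * okI x' y' z' * F x y z x' y' z'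

lemma S6_add {s b : ℕ} (F G : BMMIdx s b → BMMIdx s b → BMMIdx s b →
    BMMIdx s b → BMMIdx s b → BMMIdx s b → ℝ) :
    S6 (fun x y z x' y' z' => F x y z x' y' z' + G x y z x' y' z') = S6 F + S6 G := by
  simp only [S6, mul_add, Finset.sum_add_distrib]

lemma S6_mul {s b : ℕ} (c : ℝ) (F : BMMIdx s b → BMMIdx s b → BMMIdx s b →
    BMMIdx s b → BMMIdx s b → BMMIdx s b → ℝ) :
    S6 (fun x y z x' y' z' => c * F x y z x' y' z') = c * S6 F := by
  simp only [S6, Finset.mul_sum]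
  repeat' (refine Finset.sum_congr rfl fun _ _ => ?_)
  ring

lemma S6_mono {s b : ℕ} (F G : BMMIdx s b → BMMIdx s b → BMMIdx s b →
    BMMIdx s b → BMMIdx s b → BMMIdx s b → ℝ)
    (h : ∀ x y z x' y' z', F x y z x' y' z' ≤ G x y z x' y' z') : S6 F ≤ S6 G := by
  unfold S6
  repeat' (refine Finset.sum_le_sum fun _ _ => ?_)
  exact mul_le_mul_of_nonneg_left (h _ _ _ _ _ _) (mul_nonneg (okI_nonneg _ _ _) (okI_nonneg _ _ _))

lemma S6_x {s b : ℕ} : S6 (fun (x _ _ x' _ _ : BMMIdx s b) => if x = x' then (1 : ℝ) else 0) =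
    b ^ 5 * 25 ^ s := by
  rw [← cnt25]
  unfold S6
  refine Finset.sum_congr rfl fun x _ => ?_
  rw [sq, Finset.sum_mul]
  refine Finset.sum_congr rfl fun y _ => ?_
  rw [Finset.sum_mul]
  refine Finset.sum_congr rfl fun z _ => ?_
  rw [Finset.sum_eq_single x]
  · simp [Finset.mul_sum]
  · intro x' _ hx'
    simp [hx'.symm]
  · simp

lemma S6_xy {s b : ℕ} : S6 (fun (x y _ x' y' _ : BMMIdx s b) =>
    if x = x' ∧ y = y' then (1 : ℝ) else 0) = b ^ 4 * 13 ^ s := by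
  rw [← cnt13]
  unfold S6
  refine Finset.sum_congr rfl fun x _ => ?_
  refine Finset.sum_congr rfl fun y _ => ?_
  rw [sq, Finset.sum_mul]
  refine Finset.sum_congr rfl fun z _ => ?_
  rw [Finset.sum_eq_single x, Finset.sum_eq_single y]
  · simp [Finset.mul_sum]
  · intro x' _ hx'
    simp [hx'.symm]
  · simp
  · intro x' _ hx'
    simp [hx'.symm]
  · simp

lemma S6_swap12 {s b : ℕ} (F : BMMIdx s b → BMMIdx s b → BMMIdx s b →
    BMMIdx s b → BMMIdx s b → BMMIdx s b → ℝ) :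
    S6 F = S6 (fun x y z x' y' z' => F y x z y' x' z') := by
  unfold S6
  rw [Finset.sum_comm]
  refine Finset.sum_congr rfl fun y _ => ?_
  refine Finset.sum_congr rfl fun x _ => ?_
  refine Finset.sum_congr rfl fun z _ => ?_
  rw [Finset.sum_comm]
  refine Finset.sum_congr rfl fun y' _ => ?_
  refine Finset.sum_congr rfl fun x' _ => ?_
  refine Finset.sum_congr rfl fun z' _ => ?_
  rw [okI_symm12 x, okI_symm12 x']

lemma S6_swap23 {s b : ℕ} (F : BMMIdx s b → BMMIdx s b → BMMIdx s b →
    BMMIdx s b → BMMIdx s b → BMMIdx s b → ℝ) :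
    S6 F = S6 (fun x y z x' y' z' => F x z y x' z' y') := by
  unfold S6
  refine Finset.sum_congr rfl fun x _ => ?_
  rw [Finset.sum_comm]
  refine Finset.sum_congr rfl fun z _ => ?_
  refine Finset.sum_congr rfl fun y _ => ?_
  refine Finset.sum_congr rfl fun x' _ => ?_
  rw [Finset.sum_comm]
  refine Finset.sum_congr rfl fun z' _ => ?_
  refine Finset.sum_congr rfl fun y' _ => ?_
  rw [okI_symm23 x, okI_symm23 x']

/-- the three-element set of a triple -/
noncomputable def tri {s b : ℕ} (t : BMMIdx s b × BMMIdx s b × BMMIdx s b) :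
    Finset (BMMIdx s b ⊕ BMMIdx s b ⊕ BMMIdx s b) :=
  {Sum.inl t.1, Sum.inr (Sum.inl t.2.1), Sum.inr (Sum.inr t.2.2)}

noncomputable def pv {s b : ℕ} (p1 p2 p3 : ℝ) : BMMIdx s b ⊕ BMMIdx s b ⊕ BMMIdx s b → ℝ :=
  Sum.elim (fun _ => p1) (Sum.elim (fun _ => p2) (fun _ => p3))

noncomputable def goodT (s b : ℕ) : Finset (BMMIdx s b × BMMIdx s b × BMMIdx s b) :=
  Finset.univ.filter fun t => ok t.1 t.2.1 t.2.2

lemma prod_tri {s b : ℕ} (p1 p2 p3 : ℝ) (t : BMMIdx s b × BMMIdx s b × BMMIdx s b) :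
    ∏ v ∈ tri t, pv p1 p2 p3 v = p1 * p2 * p3 := by
  unfold tri
  rw [Finset.prod_insert (by simp), Finset.prod_insert (by simp), Finset.prod_singleton]
  simp [pv, mul_assoc]

lemma prod_tri_union {s b : ℕ} (p1 p2 p3 : ℝ) (x y z x' y' z' : BMMIdx s b) :
    ∏ v ∈ tri (x, y, z) ∪ tri (x', y', z'), pv p1 p2 p3 v =
      (if x = x' then p1 else p1 ^ 2) * (if y = y' then p2 else p2 ^ 2) *
        (if z = z' then p3 else p3 ^ 2) := by
  have : tri (x, y, z) ∪ tri (x', y', z') =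
      Finset.disjSum {x, x'} (Finset.disjSum {y, y'} {z, z'}) := by
    ext v
    rcases v with v | v | v <;> simp [tri] <;> tauto
  rw [this, Finset.prod_disjSum, Finset.prod_disjSum]
  simp only [pv, Sum.elim_inl, Sum.elim_inr, Finset.prod_const]
  have h : ∀ (u v : BMMIdx s b) (q : ℝ), q ^ (({u, v} : Finset _).card) =
      if u = v then q else q ^ 2 := by
    intro u v q
    split_ifs with h
    · subst h; simp
    · rw [Finset.card_pair h]
  rw [h, h, h, mul_assoc]

lemma sum_goodT {s b : ℕ} (F : BMMIdx s b × BMMIdx s b × BMMIdx s b → ℝ) :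
    ∑ t ∈ goodT s b, F t = ∑ x, ∑ y, ∑ z, okI x y z * F (x, y, z) := by
  unfold goodT
  rw [Finset.sum_filter, Fintype.sum_prod_type]
  refine Finset.sum_congr rfl fun x _ => ?_
  rw [Fintype.sum_prod_type]
  simp [okI]

lemma mu_eq {s b : ℕ} (p1 p2 p3 : ℝ) :
    ∑ t ∈ goodT s b, ∏ v ∈ tri t, pv p1 p2 p3 v = b ^ 3 * 7 ^ s * (p1 * p2 * p3) := by
  simp only [prod_tri]
  rw [sum_goodT, ← cnt7]
  simp only [Finset.sum_mul]

lemma delta_le {s b : ℕ} (p1 p2 p3 : ℝ) (h1 : 0 ≤ p1) (h2 : 0 ≤ p2) (h3 : 0 ≤ p3) :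
    (∑ t ∈ goodT s b, ∑ u ∈ goodT s b, if t ≠ u ∧ ¬ Disjoint (tri t) (tri u) then
      ∏ v ∈ tri t ∪ tri u, pv p1 p2 p3 v else 0) ≤
    (p1 * p2 ^ 2 * p3 ^ 2 + p1 ^ 2 * p2 * p3 ^ 2 + p1 ^ 2 * p2 ^ 2 * p3) * (b ^ 5 * 25 ^ s) +
    (p1 * p2 * p3 ^ 2 + p1 * p2 ^ 2 * p3 + p1 ^ 2 * p2 * p3) * (b ^ 4 * 13 ^ s) := by
  have hx := @S6_x s b
  have hxy := @S6_xy s b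
  have hy := S6_swap12 (fun (x _ _ x' _ _ : BMMIdx s b) => if x = x' then (1 : ℝ) else 0)
  have hz := S6_swap23 (fun (_ y _ _ y' _ : BMMIdx s b) => if y = y' then (1 : ℝ) else 0)
  have hxz := S6_swap23 (fun (x y _ x' y' _ : BMMIdx s b) =>
    if x = x' ∧ y = y' then (1 : ℝ) else 0)
  have hyz := S6_swap12 (fun (x _ z x' _ z' : BMMIdx s b) =>
    if x = x' ∧ z = z' then (1 : ℝ) else 0)
  rw [hx] at hy
  rw [← hy] at hz
  rw [hxy] at hxz
  rw [← hxz] at hyz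
  have e : (p1 * p2 ^ 2 * p3 ^ 2 + p1 ^ 2 * p2 * p3 ^ 2 + p1 ^ 2 * p2 ^ 2 * p3) *
      ((b : ℝ) ^ 5 * 25 ^ s) +
    (p1 * p2 * p3 ^ 2 + p1 * p2 ^ 2 * p3 + p1 ^ 2 * p2 * p3) * ((b : ℝ) ^ 4 * 13 ^ s) =
    S6 (fun (x y z x' y' z' : BMMIdx s b) =>
      (p1 * p2 ^ 2 * p3 ^ 2) * (if x = x' then (1 : ℝ) else 0) +
      ((p1 ^ 2 * p2 * p3 ^ 2) * (if y = y' then (1 : ℝ) else 0) +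
      ((p1 ^ 2 * p2 ^ 2 * p3) * (if z = z' then (1 : ℝ) else 0) +
      ((p1 * p2 * p3 ^ 2) * (if x = x' ∧ y = y' then (1 : ℝ) else 0) +
      ((p1 * p2 ^ 2 * p3) * (if x = x' ∧ z = z' then (1 : ℝ) else 0) +
      (p1 ^ 2 * p2 * p3) * (if y = y' ∧ z = z' then (1 : ℝ) else 0)))))) := by
    rw [S6_add, S6_add, S6_add, S6_add, S6_add, S6_mul, S6_mul, S6_mul, S6_mul, S6_mul, S6_mul,
      hx, hxy, ← hy, ← hz, ← hxz, ← hyz]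
    ring
  rw [e]
  have e2 : (∑ t ∈ goodT s b, ∑ u ∈ goodT s b, if t ≠ u ∧ ¬ Disjoint (tri t) (tri u) then
      ∏ v ∈ tri t ∪ tri u, pv p1 p2 p3 v else 0) =
      S6 (fun (x y z x' y' z' : BMMIdx s b) =>
        if (x, y, z) ≠ (x', y', z') ∧ ¬ Disjoint (tri (x, y, z)) (tri (x', y', z')) then
      ∏ v ∈ tri (x, y, z) ∪ tri (x', y', z'), pv p1 p2 p3 v else 0) := by
    unfold S6
    rw [sum_goodT]
    simp only [sum_goodT, Finset.mul_sum, mul_assoc]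
  rw [e2]
  apply S6_mono
  intro x y z x' y' z'
  rw [prod_tri_union]
  have hd : ¬ Disjoint (tri (x, y, z)) (tri (x', y', z')) ↔ (x = x' ∨ y = y' ∨ z = z') := by
    simp [tri, Finset.disjoint_left]
    tauto
  simp only [hd, ne_eq, Prod.mk.injEq]
  have q1 : 0 ≤ p1 * p2 ^ 2 * p3 ^ 2 := by positivity
  have q2 : 0 ≤ p1 ^ 2 * p2 * p3 ^ 2 := by positivity
  have q3 : 0 ≤ p1 ^ 2 * p2 ^ 2 * p3 := by positivity
  have q4 : 0 ≤ p1 * p2 * p3 ^ 2 := by positivity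
  have q5 : 0 ≤ p1 * p2 ^ 2 * p3 := by positivity
  have q6 : 0 ≤ p1 ^ 2 * p2 * p3 := by positivity
  by_cases a1 : x = x' <;> by_cases a2 : y = y' <;> by_cases a3 : z = z' <;>
    simp only [a1, a2, a3, and_self, and_true, true_and, and_false, false_and, or_true, true_or,
      or_false, not_true_eq_false, not_false_eq_true, if_true, if_false] <;> linarith

lemma col_card {I : Type*} [Fintype I] [DecidableEq I] (c : I → ZMod 2) (z0 : I) (h : c z0 = 1)
    (K : Finset (I → ZMod 2)) (hK : ∀ v ∈ K, ∑ z, c z * v z = 0) :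
    2 * K.card ≤ Fintype.card (I → ZMod 2) := by
  have hle : K.card ≤ Kᶜ.card := by
    refine Finset.card_le_card_of_injOn (fun v => v + Pi.single z0 1) ?_ ?_
    · intro v hv
      have hv' : ∑ z, c z * v z = 0 := hK v hv
      simp only [Finset.coe_compl, Set.mem_compl_iff, Finset.mem_coe]
      intro hmem
      have := hK _ hmem
      simp only [Pi.add_apply, mul_add, Finset.sum_add_distrib, hv', zero_add] at this
      rw [Finset.sum_eq_single z0] at this
      · simp [h] at this
      · intro z _ hz; simp [hz]
      · simp
    · intro u _ v _ huv
      exact add_right_cancel huv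
  have := Finset.card_add_card_compl K
  omega

lemma D_card {I : Type*} [Fintype I] [DecidableEq I] (T : Finset (I → I → ZMod 2))
    (K : I → Finset (I → ZMod 2)) (h : ∀ D ∈ T, ∀ y, (fun z => D z y) ∈ K y) :
    T.card ≤ ∏ y, (K y).card := by
  rw [← Fintype.card_piFinset]
  refine Finset.card_le_card_of_injOn (fun D y z => D z y) ?_ ?_
  · intro D hD
    simpa using h D hD
  · intro D _ D' _ h
    funext z y
    exact congrFun (congrFun h y) z

/-- `y` is reachable through active rows and active middle indices. -/
def reach {s b : ℕ} (a1 a3 : BMMIdx s b → Bool) (y : BMMIdx s b) : Prop :=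
  ∃ x z, a1 x = true ∧ a3 z = true ∧ ok x y z

lemma fixed_f {s b d1 d2 d3 : ℕ} (A : Fin d1 → Fin d3 → Bool) (B : Fin d3 → Fin d2 → Bool)
    (i : Fin d1) (j : Fin d2) (k : Fin d3) (hA : A i k = true) (hB : B k j = true)
    (f1 : BMMIdx s b → Fin d1) (f2 : BMMIdx s b → Fin d2) (f3 : BMMIdx s b → Fin d3) :
    ((Finset.univ.filter fun D : BMMIdx s b → BMMIdx s b → ZMod 2 =>
      ∀ x y, f1 x = i → f2 y = j → (∑ z ∈ Finset.univ.filter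
          (fun z : BMMIdx s b => ∀ l, (x.1 l || y.1 l || z.1 l) = true),
        (if A (f1 x) (f3 z) = true then 1 else 0) *
          ((if B (f3 z) (f2 y) = true then 1 else 0) * D z y)) = 0).card : ℝ) ≤
    ∏ y, ((Fintype.card (BMMIdx s b → ZMod 2) : ℝ) *
      (if f2 y = j ∧ reach (fun x => decide (f1 x = i)) (fun z => decide (f3 z = k)) y
        then 1 / 2 else 1)) := by
  set c : BMMIdx s b → BMMIdx s b → BMMIdx s b → ZMod 2 := fun x y z =>
    if ok x y z then (if A (f1 x) (f3 z) = true then 1 else 0) *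
          (if B (f3 z) (f2 y) = true then 1 else 0) else 0 with hc
  obtain ⟨K, hK⟩ : ∃ K : BMMIdx s b → Finset (BMMIdx s b → ZMod 2), ∀ y v, v ∈ K y ↔
      ∀ x, f1 x = i → f2 y = j → ∑ z, c x y z * v z = 0 :=
    ⟨fun y => Finset.univ.filter fun v => ∀ x, f1 x = i → f2 y = j → ∑ z, c x y z * v z = 0,
      fun y v => by rw [Finset.mem_filter]; exact and_iff_right (Finset.mem_univ _)⟩
  refine (Nat.cast_le.2 (D_card _ K ?_)).trans ?_
  · intro D hD y
    rw [Finset.mem_filter] at hD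
    rw [hK]
    intro x hx hy
    rw [← hD.2 x y hx hy, Finset.sum_filter]
    refine Finset.sum_congr rfl fun z _ => ?_
    by_cases hok : ok x y z
    · have hok' : ∀ l, (x.1 l || y.1 l || z.1 l) = true := hok
      rw [if_pos hok']
      simp only [hc]
      rw [if_pos hok, mul_assoc]
    · have hok' : ¬ ∀ l, (x.1 l || y.1 l || z.1 l) = true := hok
      rw [if_neg hok']
      simp only [hc]
      rw [if_neg hok, zero_mul]
  rw [Nat.cast_prod]
  refine Finset.prod_le_prod (fun _ _ => Nat.cast_nonneg _) fun y _ => ?_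
  by_cases hy : f2 y = j ∧ reach (fun x => decide (f1 x = i)) (fun z => decide (f3 z = k)) y
  · rw [if_pos hy]
    obtain ⟨hy, x, z, hx, hz, hok⟩ := hy
    have hx : f1 x = i := by simpa using hx
    have hz : f3 z = k := by simpa using hz
    have hc1 : c x y z = 1 := by
      simp only [hc]
      rw [if_pos hok, hx, hy, hz, if_pos hA, if_pos hB, one_mul]
    have h3 := col_card (c x y) z hc1 (K y) (fun v hv => (hK y v).1 hv x hx hy)
    have h7 : (2 : ℝ) * ((K y).card : ℝ) ≤ (Fintype.card (BMMIdx s b → ZMod 2) : ℝ) := by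
      have := (Nat.cast_le (α := ℝ)).2 h3
      rwa [Nat.cast_mul, Nat.cast_ofNat] at this
    linarith
  · rw [if_neg hy, mul_one]
    exact Nat.cast_le.2 (Finset.card_le_univ _)

lemma sum_f2 {I : Type*} [Fintype I] [DecidableEq I] {d : ℕ} (hd : 0 < d) (j : Fin d) (N : ℝ) (G : I → Prop) :
    ∑ f : I → Fin d, ∏ y, (N * (if f y = j ∧ G y then 1 / 2 else 1)) =
      (N * d) ^ Fintype.card I * ∏ y, (1 - if G y then 1 / (2 * (d : ℝ)) else 0) := by
  have := Finset.prod_univ_sum (fun _ : I => (Finset.univ : Finset (Fin d)))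
    (fun y c => (N * (if c = j ∧ G y then (1 : ℝ) / 2 else 1)))
  rw [Fintype.piFinset_univ] at this
  rw [← this, ← Finset.card_univ, ← Finset.prod_const, ← Finset.prod_mul_distrib]
  refine Finset.prod_congr rfl fun y _ => ?_
  have hd' : (d : ℝ) ≠ 0 := by positivity
  by_cases hG : G y
  · have e : ∀ c : Fin d, N * (if c = j ∧ G y then (1 : ℝ) / 2 else 1) =
        N - N * (if c = j then 1 / 2 else 0) := by
      intro c
      by_cases hcj : c = j <;> simp [hcj, hG]
      ring
    rw [Finset.sum_congr rfl fun c _ => e c, Finset.sum_sub_distrib, ← Finset.mul_sum,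
      Finset.sum_ite_eq', if_pos (Finset.mem_univ _), if_pos hG]
    simp
    field_simp
  · simp [hG]
    ring

lemma sum_fib {I : Type*} [Fintype I] [DecidableEq I] {d : ℕ} (hd : 0 < d) (i : Fin d) (F : (I → Bool) → ℝ) :
    ∑ f : I → Fin d, F (fun x => decide (f x = i)) =
      (d : ℝ) ^ Fintype.card I * ∑ a, wt (fun _ => 1 / (d : ℝ)) a * F a := by
  have hd' : (d : ℝ) ≠ 0 := by positivity
  rw [← Finset.sum_fiberwise (s := Finset.univ)
    (g := fun (f : I → Fin d) x => decide (f x = i)), Finset.mul_sum]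
  refine Finset.sum_congr rfl fun a _ => ?_
  rw [Finset.sum_congr rfl (g := fun _ => F a)
    (fun f hf => by rw [(Finset.mem_filter.1 hf).2]), Finset.sum_const, nsmul_eq_mul, ← mul_assoc]
  congr 1
  have e : (Finset.univ.filter fun f : I → Fin d => (fun x => decide (f x = i)) = a) =
      Fintype.piFinset (fun x => Finset.univ.filter fun t : Fin d => decide (t = i) = a x) := by
    ext f
    simp [funext_iff]
  rw [e, Fintype.card_piFinset, Nat.cast_prod, wt, ← Finset.card_univ, ← Finset.prod_const,
    ← Finset.prod_mul_distrib]
  refine Finset.prod_congr rfl fun x _ => ?_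
  have ht : (Finset.univ.filter fun t : Fin d => t = i).card = 1 := by
    rw [Finset.card_eq_one]; exact ⟨i, by ext; simp⟩
  rcases Bool.eq_false_or_eq_true (a x) with h | h
  · simp only [h, decide_eq_true_eq, ht]
    simp [hd']
  · simp only [h, decide_eq_false_iff_not]
    have := Finset.card_filter_add_card_filter_not (s := (Finset.univ : Finset (Fin d)))
      (fun t => t = i)
    rw [ht, Finset.card_univ, Fintype.card_fin] at this
    have h' : (1 : ℝ) + ((Finset.univ.filter fun t : Fin d => ¬ t = i).card : ℝ) = d := by
      exact_mod_cast this
    simp only [Bool.false_eq_true, if_false]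
    field_simp
    linarith

lemma sum_a2 {I : Type*} [Fintype I] [DecidableEq I] (p : ℝ) (G : I → Prop) :
    ∑ a : I → Bool, wt (fun _ => p) a * (if ∀ y, ¬ (a y = true ∧ G y) then 1 else 0) =
      ∏ y, (1 - if G y then p else 0) := by
  have := Finset.prod_univ_sum (fun _ : I => (Finset.univ : Finset Bool))
    (fun y c => (if c = true then p else 1 - p) * (if ¬ (c = true ∧ G y) then (1 : ℝ) else 0))
  rw [Fintype.piFinset_univ] at this
  have e : ∏ y, (1 - if G y then p else 0) = ∏ y, ∑ c : Bool,
      (if c = true then p else 1 - p) * (if ¬ (c = true ∧ G y) then (1 : ℝ) else 0) := by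
    refine Finset.prod_congr rfl fun y _ => ?_
    by_cases hG : G y <;> simp [hG]
  rw [e, this]
  refine Finset.sum_congr rfl fun a _ => ?_
  rw [Finset.prod_mul_distrib, wt, Finset.prod_ite_zero]
  simp

lemma combine {s b : ℕ} (p1 p2 p3 : ℝ) :
    ∑ a1 : BMMIdx s b → Bool, wt (fun _ => p1) a1 * ∑ a3 : BMMIdx s b → Bool,
      wt (fun _ => p3) a3 * ∏ y, (1 - if reach a1 a3 y then p2 else 0) =
    ∑ ω, wt (pv p1 p2 p3) ω * noI tri (goodT s b) ω := by
  rw [← (Equiv.sumArrowEquivProdArrow (BMMIdx s b) (BMMIdx s b ⊕ BMMIdx s b) Bool).symm.sum_comp,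
    Fintype.sum_prod_type]
  refine Finset.sum_congr rfl fun a1 _ => ?_
  rw [← (Equiv.sumArrowEquivProdArrow (BMMIdx s b) (BMMIdx s b) Bool).symm.sum_comp,
    Fintype.sum_prod_type, Finset.sum_comm, Finset.mul_sum]
  refine Finset.sum_congr rfl fun a3 _ => ?_
  rw [← sum_a2, Finset.mul_sum, Finset.mul_sum]
  refine Finset.sum_congr rfl fun a2 _ => ?_
  have e1 : wt (pv p1 p2 p3) ((Equiv.sumArrowEquivProdArrow (BMMIdx s b)
      (BMMIdx s b ⊕ BMMIdx s b) Bool).symm (a1, (Equiv.sumArrowEquivProdArrow (BMMIdx s b)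
      (BMMIdx s b) Bool).symm (a2, a3))) =
      wt (fun _ => p1) a1 * (wt (fun _ => p2) a2 * wt (fun _ => p3) a3) := by
    unfold wt
    rw [Fintype.prod_sum_type, Fintype.prod_sum_type]
    rfl
  rw [e1]
  have e2 : noI tri (goodT s b) ((Equiv.sumArrowEquivProdArrow (BMMIdx s b)
      (BMMIdx s b ⊕ BMMIdx s b) Bool).symm (a1, (Equiv.sumArrowEquivProdArrow (BMMIdx s b)
      (BMMIdx s b) Bool).symm (a2, a3))) =
      if ∀ y, ¬ (a2 y = true ∧ reach a1 a3 y) then 1 else 0 := by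
    unfold noI
    congr 1
    apply propext
    simp only [goodT, tri, reach, Finset.mem_filter, Finset.mem_univ, true_and,
      Finset.mem_insert, Finset.mem_singleton, forall_eq_or_imp, forall_eq]
    constructor
    · rintro H y ⟨hy, x, z, hx, hz, hok⟩
      exact H (x, y, z) hok ⟨hx, hy, hz⟩
    · rintro H ⟨x, y, z⟩ hok ⟨hx, hy, hz⟩
      exact H y ⟨hy, x, z, hx, hz, hok⟩
  rw [e2]
  ring

end BMMProof

lemma BMMProof.card_prod_le {α β : Type*} [Fintype α] (T : Finset (α × β)) (g : α → ℝ)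
    (h : ∀ a, ∃ U : Finset β, (∀ c, (a, c) ∈ T → c ∈ U) ∧ (U.card : ℝ) ≤ g a) :
    (T.card : ℝ) ≤ ∑ a, g a := by
  choose U hU hg using h
  have h1 : T.card ≤ (Finset.univ.sigma U).card := by
    refine Finset.card_le_card_of_injOn (fun t => ⟨t.1, t.2⟩) ?_ ?_
    · rintro ⟨a, c⟩ ht
      simpa using hU a c ht
    · rintro ⟨a, c⟩ _ ⟨a', c'⟩ _ h
      simpa using h
  rw [Finset.card_sigma] at h1
  refine (Nat.cast_le.2 h1).trans ?_
  rw [Nat.cast_sum]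
  exact Finset.sum_le_sum fun a _ => hg a

open BMMProof in
lemma BMMProof.exp_bound (s b d1 d2 d3 : ℕ)
    (hd1 : 0 < d1) (hd2 : 0 < d2) (hd3 : 0 < d3) (κ : ℝ)
    (hgap : (b : ℝ) ^ 3 * 7 ^ s / ((d1 : ℝ) * d2 * d3) -
        (((d1 : ℝ) + d2 + d3) * (b : ℝ) ^ 5 * 25 ^ s +
          ((d1 : ℝ) * d2 + d1 * d3 + d2 * d3) * (b : ℝ) ^ 4 * 13 ^ s) /
        (2 * ((d1 : ℝ) * d2 * d3) ^ 2) ≥ κ) :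
    ∑ ω, wt (pv (1 / (d1 : ℝ)) (1 / (2 * (d2 : ℝ))) (1 / (d3 : ℝ))) ω * noI tri (goodT s b) ω ≤
      Real.exp (-κ / 2) := by
  have hd1' : (1 : ℝ) ≤ d1 := by exact_mod_cast hd1
  have hd2' : (1 : ℝ) ≤ d2 := by exact_mod_cast hd2
  have hd3' : (1 : ℝ) ≤ d3 := by exact_mod_cast hd3
  have hp1 : 0 ≤ 1 / (d1 : ℝ) := by positivity
  have hp2 : 0 ≤ 1 / (2 * (d2 : ℝ)) := by positivity
  have hp3 : 0 ≤ 1 / (d3 : ℝ) := by positivity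
  refine (janson _ ?_ ?_ _ _).trans (Real.exp_le_exp.2 ?_)
  · rintro (v | v | v) <;> simp only [pv, Sum.elim_inl, Sum.elim_inr] <;> assumption
  · rintro (v | v | v) <;> simp only [pv, Sum.elim_inl, Sum.elim_inr] <;>
      rw [div_le_one (by positivity)] <;> linarith
  · rw [mu_eq]
    have hD := delta_le (s := s) (b := b) _ _ _ hp1 hp2 hp3
    set P5 : ℝ := (b : ℝ) ^ 5 * 25 ^ s with hP5
    set P4 : ℝ := (b : ℝ) ^ 4 * 13 ^ s with hP4
    set P3 : ℝ := (b : ℝ) ^ 3 * 7 ^ s with hP3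
    have h5 : 0 ≤ P5 := by positivity
    have h4 : 0 ≤ P4 := by positivity
    obtain ⟨u, hu⟩ : ∃ u : ℝ, u = 1 / (d1 : ℝ) := ⟨_, rfl⟩
    obtain ⟨v, hv⟩ : ∃ v : ℝ, v = 1 / (d2 : ℝ) := ⟨_, rfl⟩
    obtain ⟨w, hw⟩ : ∃ w : ℝ, w = 1 / (d3 : ℝ) := ⟨_, rfl⟩
    have hv2 : 1 / (2 * (d2 : ℝ)) = v / 2 := by rw [hv]; field_simp
    have hg : P3 * (u * v * w) - ((u * v ^ 2 * w ^ 2 + u ^ 2 * v * w ^ 2 + u ^ 2 * v ^ 2 * w) * P5 +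
        (u * v * w ^ 2 + u * v ^ 2 * w + u ^ 2 * v * w) * P4) / 2 ≥ κ := by
      refine le_of_le_of_eq hgap ?_
      rw [hu, hv, hw, hP3, hP4, hP5]
      field_simp
    rw [hv2, ← hu, ← hw] at hD ⊢
    rw [← hu] at hp1
    rw [← hw] at hp3
    have hv0 : 0 ≤ v := by rw [hv]; positivity
    have hq : (u * (v / 2) ^ 2 * w ^ 2 + u ^ 2 * (v / 2) * w ^ 2 + u ^ 2 * (v / 2) ^ 2 * w) * P5 +
        (u * (v / 2) * w ^ 2 + u * (v / 2) ^ 2 * w + u ^ 2 * (v / 2) * w) * P4 ≤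
        ((u * v ^ 2 * w ^ 2 + u ^ 2 * v * w ^ 2 + u ^ 2 * v ^ 2 * w) * P5 +
        (u * v * w ^ 2 + u * v ^ 2 * w + u ^ 2 * v * w) * P4) / 2 := by
      have t1 : 0 ≤ u * v ^ 2 * w ^ 2 * P5 := by positivity
      have t2 : 0 ≤ u ^ 2 * v ^ 2 * w * P5 := by positivity
      have t3 : 0 ≤ u * v ^ 2 * w * P4 := by positivity
      linarith
    linarith

open BMMProof

/-- instance-free form of `fixed_f` -/
lemma BMMProof.fixed_f_exists {s b d1 d2 d3 : ℕ} (A : Fin d1 → Fin d3 → Bool)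
    (B : Fin d3 → Fin d2 → Bool)
    (i : Fin d1) (j : Fin d2) (k : Fin d3) (hA : A i k = true) (hB : B k j = true)
    (f1 : BMMIdx s b → Fin d1) (f2 : BMMIdx s b → Fin d2) (f3 : BMMIdx s b → Fin d3) :
    ∃ U : Finset (BMMIdx s b → BMMIdx s b → ZMod 2),
      (∀ D : BMMIdx s b → BMMIdx s b → ZMod 2,
      (∀ x y, f1 x = i → f2 y = j → (∑ z ∈ Finset.univ.filter
          (fun z : BMMIdx s b => ∀ l, (x.1 l || y.1 l || z.1 l) = true),
        (if A (f1 x) (f3 z) = true then 1 else 0) *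
          ((if B (f3 z) (f2 y) = true then 1 else 0) * D z y)) = 0) → D ∈ U) ∧
      (U.card : ℝ) ≤ ∏ y, ((Fintype.card (BMMIdx s b → ZMod 2) : ℝ) *
      (if f2 y = j ∧ reach (fun x => decide (f1 x = i)) (fun z => decide (f3 z = k)) y
        then 1 / 2 else 1)) := by
  refine ⟨_, ?_, fixed_f A B i j k hA hB f1 f2 f3⟩
  intro D hD
  rw [Finset.mem_filter]
  exact ⟨Finset.mem_univ _, hD⟩

/-- If `A_{i*k*} = B_{k*j*} = 1` and `κ` is a positive integer with
`b^3·7^s/ψ3 − (ψ1·b^5·25^s + ψ2·b^4·13^s)/(2ψ3^2) ≥ κ`, then over the uniform choice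
of `f1, f2, f3, D`, the estimated entry satisfies `Pr(C̃_{i*j*} = 0) ≤ 2^{−κ} + κe^{−κ/2}`. -/
theorem bmm_false_negative_bound (s b d1 d2 d3 : ℕ)
    (hb : 0 < b) (hd1 : 0 < d1) (hd2 : 0 < d2) (hd3 : 0 < d3)
    (A : Fin d1 → Fin d3 → Bool) (B : Fin d3 → Fin d2 → Bool)
    (istar : Fin d1) (jstar : Fin d2) (kstar : Fin d3)
    (hA : A istar kstar = true) (hB : B kstar jstar = true)
    (κ : ℕ) (hκ : 0 < κ)
    (hgap : (b : ℝ) ^ 3 * 7 ^ s / ((d1 : ℝ) * d2 * d3) -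
        (((d1 : ℝ) + d2 + d3) * (b : ℝ) ^ 5 * 25 ^ s +
          ((d1 : ℝ) * d2 + d1 * d3 + d2 * d3) * (b : ℝ) ^ 4 * 13 ^ s) /
        (2 * ((d1 : ℝ) * d2 * d3) ^ 2) ≥ (κ : ℝ)) :
    let Cbar : BMMSampD s b d1 d2 d3 → BMMIdx s b → BMMIdx s b → ZMod 2 :=
      fun ω x y => ∑ z ∈ Finset.univ.filter
          (fun z : BMMIdx s b => ∀ l, (x.1 l || y.1 l || z.1 l) = true),
        (if A (ω.1.1 x) (ω.1.2.2 z) = true then 1 else 0) *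
          ((if B (ω.1.2.2 z) (ω.1.2.1 y) = true then 1 else 0) * ω.2 z y)
    ((Finset.univ.filter (fun ω : BMMSampD s b d1 d2 d3 =>
        ∀ x y, ω.1.1 x = istar → ω.1.2.1 y = jstar → Cbar ω x y = 0)).card : ℝ) /
      (Fintype.card (BMMSampD s b d1 d2 d3) : ℝ) ≤
        (1 / 2 : ℝ) ^ κ + (κ : ℝ) * Real.exp (-(κ : ℝ) / 2) := by
  intro Cbar
  set n := Fintype.card (BMMIdx s b) with hn
  set N : ℝ := (Fintype.card (BMMIdx s b → ZMod 2) : ℝ) with hN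
  have hNpos : 0 < N := by rw [hN]; exact Nat.cast_pos.2 Fintype.card_pos
  have hexp := BMMProof.exp_bound s b d1 d2 d3 hd1 hd2 hd3 κ hgap
  have hcard : (Fintype.card (BMMSampD s b d1 d2 d3) : ℝ) =
      (d1 : ℝ) ^ n * (d3 : ℝ) ^ n * (N * d2) ^ n := by
    rw [hN]
    simp only [BMMSampD, Fintype.card_prod, Fintype.card_fun, Fintype.card_fin, ← hn]
    push_cast
    ring
  have hnum : ((Finset.univ.filter (fun ω : BMMSampD s b d1 d2 d3 =>
        ∀ x y, ω.1.1 x = istar → ω.1.2.1 y = jstar → Cbar ω x y = 0)).card : ℝ) ≤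
      ((d1 : ℝ) ^ n * (d3 : ℝ) ^ n * (N * d2) ^ n) * Real.exp (-(κ : ℝ) / 2) := by
    calc _ ≤ ∑ f : (BMMIdx s b → Fin d1) × (BMMIdx s b → Fin d2) × (BMMIdx s b → Fin d3),
          ∏ y, (N * (if f.2.1 y = jstar ∧ reach (fun x => decide (f.1 x = istar))
            (fun z => decide (f.2.2 z = kstar)) y then 1 / 2 else 1)) :=
          by
          apply card_prod_le
          rintro ⟨f1, f2, f3⟩
          obtain ⟨U, hU, hg⟩ := fixed_f_exists A B istar jstar kstar hA hB f1 f2 f3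
          refine ⟨U, fun D hD => hU D ?_, hg⟩
          rw [Finset.mem_filter] at hD
          exact hD.2
      _ = ∑ f1 : BMMIdx s b → Fin d1, ∑ f3 : BMMIdx s b → Fin d3,
            ∑ f2 : BMMIdx s b → Fin d2, ∏ y, (N * (if f2 y = jstar ∧
              reach (fun x => decide (f1 x = istar))
              (fun z => decide (f3 z = kstar)) y then 1 / 2 else 1)) := by
          rw [Fintype.sum_prod_type]
          refine Finset.sum_congr rfl fun f1 _ => ?_
          rw [Fintype.sum_prod_type, Finset.sum_comm]
      _ = ∑ f1 : BMMIdx s b → Fin d1, ∑ f3 : BMMIdx s b → Fin d3,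
            (N * d2) ^ n * ∏ y, (1 - if reach (fun x => decide (f1 x = istar))
              (fun z => decide (f3 z = kstar)) y then 1 / (2 * (d2 : ℝ)) else 0) := by
          refine Finset.sum_congr rfl fun f1 _ => ?_
          refine Finset.sum_congr rfl fun f3 _ => ?_
          rw [sum_f2 hd2]
      _ = ((d1 : ℝ) ^ n * (d3 : ℝ) ^ n * (N * d2) ^ n) *
            ∑ ω, wt (pv (1 / (d1 : ℝ)) (1 / (2 * (d2 : ℝ))) (1 / (d3 : ℝ))) ω *
              noI tri (goodT s b) ω := by
          rw [← combine]
          simp only [← Finset.mul_sum]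
          have h3 : ∀ f1 : BMMIdx s b → Fin d1, _ := fun f1 =>
            sum_fib hd3 kstar (fun a3 : BMMIdx s b → Bool =>
              ∏ y, (1 - if reach (fun x => decide (f1 x = istar)) a3 y then
                1 / (2 * (d2 : ℝ)) else 0))
          rw [Finset.sum_congr rfl fun f1 _ => h3 f1, ← Finset.mul_sum]
          have h1 := sum_fib hd1 istar (fun a1 : BMMIdx s b → Bool =>
            ∑ a3 : BMMIdx s b → Bool, wt (fun _ => 1 / (d3 : ℝ)) a3 *
              ∏ y, (1 - if reach a1 a3 y then 1 / (2 * (d2 : ℝ)) else 0))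
          rw [h1]
          ring
      _ ≤ _ := mul_le_mul_of_nonneg_left hexp (by positivity)
  rw [hcard, div_le_iff₀ (by positivity)]
  refine hnum.trans ?_
  rw [mul_comm]
  refine mul_le_mul_of_nonneg_right ?_ (by positivity)
  have hκ1 : (1 : ℝ) ≤ κ := by exact_mod_cast hκ
  have he := Real.exp_pos (-(κ : ℝ) / 2)
  have : (0 : ℝ) ≤ (1 / 2 : ℝ) ^ κ := by positivity
  nlinarith
end
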